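/- arXiv:2307.12669 — 2 statements merged into one kernel-verified Lean document; each statement's English description precedes it below -/
import Mathlib

section
/- Let n ≥ 2, let K be a field, let A_n be the ladder graph on 2n vertices, and let S = K[V(A_n)]. Then sdepth(S/I(A_n)) ≥ depth(S/I(A_n)) = ⌈n/2⌉. -/
open MvPolynomial

/-- The edge ideal of a simple graph `G`, inside `K[x_v : v ∈ V]`. -/
noncomputable def edgeIdeal (K : Type*) [Field K] {V : Type*} (G : SimpleGraph V) :
    Ideal (MvPolynomial V K) :=
  Ideal.span {m | ∃ i j : V, G.Adj i j ∧ m = X i * X j}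

/-- The graded maximal ideal of `K[x_v : v ∈ V]`. -/
noncomputable def maxIdeal (K : Type*) [Field K] (V : Type*) : Ideal (MvPolynomial V K) :=
  Ideal.span (Set.range (X : V → MvPolynomial V K))

/-- depth of `S/I` over `S = K[x_v]`: the supremum of lengths of regular sequences on `S/I`
consisting of elements of the graded maximal ideal. -/
noncomputable def depthQuot {K : Type*} [Field K] {V : Type*} (I : Ideal (MvPolynomial V K)) : ℕ :=
  sSup {n : ℕ | ∃ rs : List (MvPolynomial V K), rs.length = n ∧
    (∀ r ∈ rs, r ∈ maxIdeal K V) ∧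
    RingTheory.Sequence.IsRegular (MvPolynomial V K ⧸ I) rs}

/-- The Stanley space `u·K[Z]` inside `S/I`, as a `K`-subspace. -/
noncomputable def stanleySpace {K : Type*} [Field K] {V : Type*}
    (I : Ideal (MvPolynomial V K)) (u : V →₀ ℕ) (Z : Finset V) :
    Submodule K (MvPolynomial V K ⧸ I) :=
  Submodule.span K
    {x | ∃ a : V →₀ ℕ, a.support ⊆ Z ∧ x = Ideal.Quotient.mk I (monomial (u + a) (1 : K))}

/-- A Stanley decomposition of `S/I`: a finite family of Stanley spaces `u_j K[Z_j]`,
each of which is a free `K[Z_j]`-module (expressed by linear independence of the monomial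
spanning set), whose internal direct sum is all of `S/I`. -/
structure StanleyDecomposition {K : Type*} [Field K] {V : Type*}
    (I : Ideal (MvPolynomial V K)) : Type _ where
  m : ℕ
  u : Fin m → (V →₀ ℕ)
  Z : Fin m → Finset V
  free : ∀ j : Fin m, LinearIndependent K
    (fun a : {a : V →₀ ℕ // a.support ⊆ Z j} =>
      Ideal.Quotient.mk I (monomial (u j + (a : V →₀ ℕ)) (1 : K)))
  internal : DirectSum.IsInternal (fun j : Fin m => stanleySpace I (u j) (Z j))

/-- The Stanley depth of `S/I`. -/
noncomputable def sdepthQuot {K : Type*} [Field K] {V : Type*}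
    (I : Ideal (MvPolynomial V K)) : ℕ :=
  sSup {n : ℕ | ∃ D : StanleyDecomposition I, ∀ j, n ≤ (D.Z j).card}

/-- `pdimLE R n M`: the `R`-module `M` has projective dimension at most `n`,
i.e. it admits a projective resolution of length `n`. -/
def pdimLE (R : Type*) [CommRing R] :
    (n : ℕ) → (M : Type*) → [AddCommGroup M] → [Module R M] → Prop
  | 0, M, _, _ => Module.Projective R M
  | (n+1), M, _, _ => ∃ (P : Type _) (_ : AddCommGroup P) (_ : Module R P)
      (f : P →ₗ[R] M), Module.Projective R P ∧ Function.Surjective f ∧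
        pdimLE R n (LinearMap.ker f)

/-- The projective dimension of `S/I` over `S`: the length of a minimal (projective/free)
resolution, i.e. the least `n` such that `S/I` has a projective resolution of length `n`. -/
noncomputable def pdimQuot {K : Type*} [Field K] {V : Type*}
    (I : Ideal (MvPolynomial V K)) : ℕ :=
  sInf {n : ℕ | pdimLE (MvPolynomial V K) n (MvPolynomial V K ⧸ I)}

/-- The ladder graph `A n` on `2n` vertices: `inl i = x_{i+1}`, `inr i = y_{i+1}`. -/
def graphA (n : ℕ) : SimpleGraph (Fin n ⊕ Fin n) :=
  SimpleGraph.fromRel (fun a b =>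
    match a, b with
    | .inl i, .inl j => (i : ℕ) + 1 = j
    | .inr i, .inr j => (i : ℕ) + 1 = j
    | .inl i, .inr j => (i : ℕ) = (j : ℕ)
    | .inr _, .inl _ => False)

/-- The graph `B n`: the ladder `A n` with one extra vertex `y_{n+1}` and edge `{y_n, y_{n+1}}`.
Here `inl i = x_{i+1}` (`i < n`) and `inr i = y_{i+1}` (`i < n+1`). -/
def graphB (n : ℕ) : SimpleGraph (Fin n ⊕ Fin (n+1)) :=
  SimpleGraph.fromRel (fun a b =>
    match a, b with
    | .inl i, .inl j => (i : ℕ) + 1 = j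
    | .inr i, .inr j => (i : ℕ) + 1 = j
    | .inl i, .inr j => (i : ℕ) = (j : ℕ)
    | .inr _, .inl _ => False)

/-- The graph `C n`: the ladder `A n` with two extra vertices `y_{n+1}, y_{n+2}` and extra
edges `{y_n, y_{n+1}}` and `{y_1, y_{n+2}}`. Here `inl i = x_{i+1}` (`i < n`) and
`inr i = y_{i+1}` (`i < n+2`). -/
def graphC (n : ℕ) : SimpleGraph (Fin n ⊕ Fin (n+2)) :=
  SimpleGraph.fromRel (fun a b =>
    match a, b with
    | .inl i, .inl j => (i : ℕ) + 1 = j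
    | .inr i, .inr j => ((i : ℕ) + 1 = j ∧ (j : ℕ) ≤ n) ∨ ((i : ℕ) = 0 ∧ (j : ℕ) = n + 1)
    | .inl i, .inr j => (i : ℕ) = (j : ℕ)
    | .inr _, .inl _ => False)

/-- The graph `D n`: the ladder `A n` with two extra vertices `x_{n+1}, y_{n+1}` and extra
edges `{y_n, y_{n+1}}` and `{x_1, x_{n+1}}`. Here `inl i = x_{i+1}` and `inr i = y_{i+1}`
(`i < n+1`). -/
def graphD (n : ℕ) : SimpleGraph (Fin (n+1) ⊕ Fin (n+1)) :=
  SimpleGraph.fromRel (fun a b =>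
    match a, b with
    | .inl i, .inl j => ((i : ℕ) + 1 = j ∧ (j : ℕ) ≤ n - 1) ∨ ((i : ℕ) = 0 ∧ (j : ℕ) = n)
    | .inr i, .inr j => (i : ℕ) + 1 = j
    | .inl i, .inr j => (i : ℕ) = (j : ℕ) ∧ (i : ℕ) ≤ n - 1
    | .inr _, .inl _ => False)

/-- The circulant graph `C_q(s)` on vertex set `{x_1, …, x_q}` (realized as `Fin q`):
`x_i` and `x_j` are adjacent iff `|i - j| ∈ s` or `q - |i - j| ∈ s`. -/
def circulantGraph (q : ℕ) (s : Set ℕ) : SimpleGraph (Fin q) :=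
  SimpleGraph.fromRel (fun i j =>
    ((i : ℤ) - (j : ℤ)).natAbs ∈ s ∨ q - ((i : ℤ) - (j : ℤ)).natAbs ∈ s)


namespace Ladder

set_option linter.unusedSectionVars false

open CategoryTheory Abelian

section Combinatorics

variable {V : Type} [DecidableEq V]

/-- A family of finsets closed under taking subsets. -/
def IsComplex (Δ : Set (Finset V)) : Prop := ∀ σ ∈ Δ, ∀ τ, τ ⊆ σ → τ ∈ Δ

/-- Independent sets of `G` contained in `R`. -/
def ind (G : SimpleGraph V) (R : Set V) : Set (Finset V) :=
  {σ | (∀ i ∈ σ, i ∈ R) ∧ ∀ i ∈ σ, ∀ j ∈ σ, ¬ G.Adj i j}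

lemma ind_isComplex (G : SimpleGraph V) (R : Set V) : IsComplex (ind G R) := by
  intro σ hσ τ h
  exact ⟨fun i hi => hσ.1 i (h hi), fun i hi j hj => hσ.2 i (h hi) j (h hj)⟩

/-- Combinatorial certificate for lower bounds of depth and Stanley depth. -/
inductive Good (G : SimpleGraph V) : Set V → ℕ → Prop
  | zero (R : Set V) : Good G R 0
  | split {R : Set V} {r : ℕ} (v : V) (hv : v ∈ R) (h1 : Good G (R \ {v}) r)
      (h2 : Good G (R \ {w | G.Adj v w}) r) : Good G R r
  | iso {R : Set V} {r : ℕ} (v : V) (hv : v ∈ R) (hw : ∀ w ∈ R, ¬ G.Adj v w)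
      (h1 : Good G (R \ {v}) r) : Good G R (r + 1)

/-- Partition of the monomials supported on faces into Stanley cones of dimension at least `r`. -/
def HasPart (Δ : Set (Finset V)) (r : ℕ) : Prop :=
  ∃ (ι : Type) (_ : Fintype ι) (u : ι → (V →₀ ℕ)) (Z : ι → Finset V),
    (∀ j, r ≤ (Z j).card) ∧
    (∀ a : V →₀ ℕ, a.support ∈ Δ → ∃ j, ∃ b : V →₀ ℕ, b.support ⊆ Z j ∧ a = u j + b) ∧
    (∀ j (b : V →₀ ℕ), b.support ⊆ Z j → (u j + b).support ∈ Δ) ∧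
    (∀ j j' (b b' : V →₀ ℕ), b.support ⊆ Z j → b'.support ⊆ Z j' → u j + b = u j' + b' → j = j')

lemma supp_add (a b : V →₀ ℕ) : (a + b).support = a.support ∪ b.support := by
  ext i
  simp only [Finsupp.mem_support_iff, Finsupp.add_apply, Finset.mem_union]
  omega

lemma supp_single_add (v : V) (a : V →₀ ℕ) :
    (Finsupp.single v 1 + a).support = insert v a.support := by
  rw [supp_add, Finsupp.support_single _ one_ne_zero]; rfl

lemma mem_ind_insert (G : SimpleGraph V) (R : Set V) (v : V) (hv : v ∈ R) (σ : Finset V) :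
    insert v σ ∈ ind G R ↔ σ ∈ ind G (R \ {w | G.Adj v w}) := by
  simp only [ind, Set.mem_ofPred_eq, Finset.mem_insert, Set.mem_sdiff]
  constructor
  · rintro ⟨h1, h2⟩
    exact ⟨fun i hi => ⟨h1 i (Or.inr hi), h2 v (Or.inl rfl) i (Or.inr hi)⟩,
      fun i hi j hj => h2 i (Or.inr hi) j (Or.inr hj)⟩
  · rintro ⟨h1, h2⟩
    refine ⟨?_, ?_⟩
    · rintro i (rfl | hi)
      · exact hv
      · exact (h1 i hi).1
    · rintro i (rfl | hi) j (rfl | hj)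
      · exact G.loopless.irrefl _
      · exact (h1 j hj).2
      · exact fun h => (h1 i hi).2 h.symm
      · exact h2 i hi j hj

lemma mem_ind_del (G : SimpleGraph V) (R : Set V) (v : V) (σ : Finset V) :
    σ ∈ ind G (R \ {v}) ↔ σ ∈ ind G R ∧ v ∉ σ := by
  simp only [ind, Set.mem_ofPred_eq, Set.mem_sdiff, Set.mem_singleton_iff]
  constructor
  · rintro ⟨h1, h2⟩
    exact ⟨⟨fun i hi => (h1 i hi).1, h2⟩, fun h => (h1 v h).2 rfl⟩
  · rintro ⟨⟨h1, h2⟩, h3⟩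
    exact ⟨fun i hi => ⟨h1 i hi, fun h => h3 (h ▸ hi)⟩, h2⟩

lemma exists_single_add {v : V} {a : V →₀ ℕ} (h : a v ≠ 0) :
    ∃ b, a = Finsupp.single v 1 + b := by
  refine ⟨a - Finsupp.single v 1, ?_⟩
  rw [add_comm, tsub_add_cancel_of_le]
  rw [Finsupp.single_le_iff]
  omega

lemma Good.hasPart [Fintype V] {G : SimpleGraph V} {R : Set V} {r : ℕ} (h : Good G R r) :
    HasPart (ind G R) r := by
  classical
  induction h with
  | zero R =>
    refine ⟨{σ : Finset V // σ ∈ ind G R}, inferInstance,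
      fun σ => σ.1.sum (fun v => Finsupp.single v 1), fun σ => σ.1, fun _ => Nat.zero_le _, ?_⟩
    have key : ∀ (σ : Finset V) (b : V →₀ ℕ), b.support ⊆ σ →
        ((σ.sum (fun v => Finsupp.single v 1) : V →₀ ℕ) + b).support = σ := by
      intro σ b hb
      ext i
      have : ((σ.sum (fun v => Finsupp.single v 1) : V →₀ ℕ)) i = if i ∈ σ then 1 else 0 := by
        rw [Finsupp.finsetSum_apply]
        simp [Finsupp.single_apply]
      rw [Finsupp.mem_support_iff, Finsupp.add_apply, this]
      by_cases hi : i ∈ σ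
      · simp [hi]
      · have : b i = 0 := by
          by_contra h
          exact hi (hb (Finsupp.mem_support_iff.2 h))
        simp [hi, this]
    refine ⟨?_, ?_, ?_⟩
    · intro a ha
      refine ⟨⟨a.support, ha⟩, a - a.support.sum (fun v => Finsupp.single v 1), ?_, ?_⟩
      · intro i hi
        simp only [Finsupp.mem_support_iff, Finsupp.tsub_apply] at hi ⊢
        omega
      · rw [add_comm, tsub_add_cancel_of_le]
        intro i
        rw [Finsupp.finsetSum_apply]
        simp only [Finsupp.single_apply, Finset.sum_ite_eq', Finsupp.mem_support_iff]
        split_ifs <;> omega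
    · rintro ⟨σ, hσ⟩ b hb
      rw [key σ b hb]; exact hσ
    · rintro ⟨σ, hσ⟩ ⟨τ, hτ⟩ b b' hb hb' h
      have := congrArg Finsupp.support h
      rw [key σ b hb, key τ b' hb'] at this
      exact Subtype.ext this
  | @split R r v hv _ _ ih1 ih2 =>
    obtain ⟨ι, _, u, Z, h1, h2, h3, h4⟩ := ih1
    obtain ⟨κ, _, u', Z', k1, k2, k3, k4⟩ := ih2
    refine ⟨ι ⊕ κ, inferInstance, Sum.elim u (fun j => Finsupp.single v 1 + u' j), Sum.elim Z Z',
      ?_, ?_, ?_, ?_⟩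
    · rintro (j | j)
      · exact h1 j
      · exact k1 j
    · intro a ha
      by_cases hav : a v = 0
      · obtain ⟨j, b, hb, e⟩ := h2 a ((mem_ind_del _ _ _ _).2 ⟨ha, by simpa using hav⟩)
        exact ⟨Sum.inl j, b, hb, e⟩
      · obtain ⟨c, rfl⟩ := exists_single_add hav
        rw [supp_single_add, mem_ind_insert _ _ _ hv] at ha
        obtain ⟨j, b, hb, e⟩ := k2 c ha
        exact ⟨Sum.inr j, b, hb, by rw [e]; simp [add_assoc]⟩
    · rintro (j | j) b hb
      · exact ((mem_ind_del _ _ _ _).1 (h3 j b hb)).1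
      · simp only [Sum.elim_inr]
        rw [add_assoc, supp_single_add, mem_ind_insert _ _ _ hv]
        exact k3 j b hb
    · have aux : ∀ j j' (b b' : V →₀ ℕ), b.support ⊆ Z j →
          u j + b = Finsupp.single v 1 + u' j' + b' → False := by
        intro j j' b b' hb e
        have := ((mem_ind_del _ _ _ _).1 (h3 j b hb)).2
        rw [e, add_assoc, supp_single_add] at this
        simp at this
      rintro (j | j) (j' | j') b b' hb hb' e
      · rw [h4 j j' b b' hb hb' e]
      · exact (aux j j' b b' hb e).elim
      · exact (aux j' j b' b hb' e.symm).elim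
      · simp only [Sum.elim_inr, add_assoc] at e
        rw [k4 j j' b b' hb hb' (add_left_cancel e)]
  | @iso R r v hv hw _ ih1 =>
    obtain ⟨ι, _, u, Z, h1, h2, h3, h4⟩ := ih1
    have hZ : ∀ j, v ∉ Z j := by
      intro j hj
      have := ((mem_ind_del _ _ _ _).1 (h3 j (Finsupp.single v 1)
        (Finsupp.support_single_subset.trans (by simpa using hj)))).2
      rw [add_comm, supp_single_add] at this
      simp at this
    have hR : R \ {w | G.Adj v w} = R := by
      ext w
      simp only [Set.mem_sdiff, Set.mem_ofPred_eq, and_iff_left_iff_imp]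
      exact hw w
    have huv : ∀ j, u j v = 0 := by
      intro j
      have := ((mem_ind_del _ _ _ _).1 (h3 j 0 (by simp))).2
      simpa using this
    have her : ∀ (j) (b : V →₀ ℕ), b.support ⊆ insert v (Z j) → (b.erase v).support ⊆ Z j := by
      intro j b hb
      rw [Finsupp.support_erase]
      intro i hi
      have := hb (Finset.mem_of_mem_erase hi)
      rcases Finset.mem_insert.1 this with rfl | h
      · simp at hi
      · exact h
    have hE : ∀ j (b : V →₀ ℕ), (u j + b).erase v = u j + b.erase v := by
      intro j b
      rw [Finsupp.erase_add]
      congr 1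
      rw [Finsupp.erase_of_notMem_support]
      simpa using huv j
    refine ⟨ι, inferInstance, u, fun j => insert v (Z j), ?_, ?_, ?_, ?_⟩
    · intro j
      rw [Finset.card_insert_of_notMem (hZ j)]
      exact Nat.succ_le_succ (h1 j)
    · intro a ha
      obtain ⟨j, b, hb, e⟩ := h2 (a.erase v) ((mem_ind_del _ _ _ _).2
        ⟨ind_isComplex G R _ ha _ (by rw [Finsupp.support_erase]; exact Finset.erase_subset _ _),
          by simp⟩)
      refine ⟨j, b + Finsupp.single v (a v), ?_, ?_⟩
      · rw [supp_add]
        refine Finset.union_subset (hb.trans (Finset.subset_insert _ _)) ?_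
        exact Finsupp.support_single_subset.trans (by simp)
      · rw [← add_assoc, ← e, Finsupp.erase_add_single]
    · intro j b hb
      have := h3 j _ (her j b hb)
      rw [← hE, mem_ind_del] at this
      have h5 := this.1
      rw [← hR, ← mem_ind_insert _ _ _ hv, Finsupp.support_erase] at h5
      refine ind_isComplex G R _ h5 _ ?_
      exact Finset.subset_insert_iff.2 subset_rfl
    · intro j j' b b' hb hb' e
      refine h4 j j' _ _ (her j b hb) (her j' b' hb') ?_
      rw [← hE, ← hE, e]

end Combinatorics

section LadderCombinatorics

variable {n : ℕ}

lemma Good.mono {V : Type} [DecidableEq V] {G : SimpleGraph V} {R : Set V} {r : ℕ}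
    (h : Good G R r) : ∀ {r' : ℕ}, r' ≤ r → Good G R r' := by
  induction h with
  | zero R => intro r' h; obtain rfl : r' = 0 := by omega
              exact Good.zero R
  | split v hv _ _ ih1 ih2 => intro r' h; exact Good.split v hv (ih1 h) (ih2 h)
  | iso v hv hw _ ih =>
    intro r' h
    cases r' with
    | zero => exact Good.zero _
    | succ r' => exact Good.iso v hv hw (ih (by omega))

/-- column of a vertex -/
def col (v : Fin n ⊕ Fin n) : ℕ := Sum.elim Fin.val Fin.val v

/-- row of a vertex -/
def sd (v : Fin n ⊕ Fin n) : Bool := v.isLeft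

lemma vext {v w : Fin n ⊕ Fin n} : v = w ↔ col v = col w ∧ sd v = sd w := by
  rcases v with v | v <;> rcases w with w | w <;> simp [col, sd, Fin.ext_iff]

lemma vexists (k : ℕ) (hk : k < n) (s : Bool) : ∃ v : Fin n ⊕ Fin n, col v = k ∧ sd v = s := by
  cases s
  · exact ⟨Sum.inr ⟨k, hk⟩, rfl, rfl⟩
  · exact ⟨Sum.inl ⟨k, hk⟩, rfl, rfl⟩

lemma col_lt (v : Fin n ⊕ Fin n) : col v < n := by
  rcases v with v | v <;> exact v.2

lemma adjA {v w : Fin n ⊕ Fin n} : (graphA n).Adj v w ↔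
    (sd v = sd w ∧ (col v + 1 = col w ∨ col w + 1 = col v)) ∨ (sd v ≠ sd w ∧ col v = col w) := by
  rcases v with v | v <;> rcases w with w | w <;>
    simp [graphA, col, sd, SimpleGraph.fromRel_adj, Fin.ext_iff] <;> omega

/-- first `k` columns and one vertex of the next one -/
def RB (n k : ℕ) (s : Bool) : Set (Fin n ⊕ Fin n) := {v | col v < k ∨ (col v = k ∧ sd v = s)}

lemma good_RB (k : ℕ) : ∀ (_ : k < n) (s : Bool), Good (graphA n) (RB n k s) (k / 2 + 1) := by
  induction k using Nat.strong_induction_on with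
  | _ k ih =>
  intro hk s
  obtain ⟨p, hp, hps⟩ := vexists (n := n) k hk s
  rcases Nat.eq_zero_or_pos k with rfl | hpos
  · refine Good.iso p ?_ ?_ (Good.zero _)
    · simp [RB, hp, hps]
    · intro w hw
      simp only [RB, Set.mem_ofPred_eq] at hw
      rw [adjA]
      grind
  obtain ⟨v, hv, hvs⟩ := vexists (n := n) (k - 1) (by omega) s
  refine Good.split v ?_ ?_ ?_
  · simp only [RB, Set.mem_ofPred_eq]; omega
  · refine Good.mono (r := ((k - 1) / 2 + 1) + 1) ?_ (by omega)
    refine Good.iso p ?_ ?_ ?_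
    · simp only [RB, Set.mem_ofPred_eq, Set.mem_sdiff, Set.mem_singleton_iff, vext]
      exact ⟨Or.inr ⟨hp, hps⟩, fun h => by omega⟩
    · intro w hw
      simp only [RB, Set.mem_ofPred_eq, Set.mem_sdiff, Set.mem_singleton_iff, vext] at hw
      rw [adjA]
      grind
    · have : (RB n k s \ {v}) \ {p} = RB n (k - 1) (!s) := by
        ext x
        simp only [RB, Set.mem_ofPred_eq, Set.mem_sdiff, Set.mem_singleton_iff, vext]
        cases s <;> cases hx : sd x <;> simp_all <;> omega
      rw [this]
      exact ih _ (by omega) (by omega) _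
  · have hviso : ∀ w ∈ RB n k s \ {w | (graphA n).Adj v w}, ¬ (graphA n).Adj v w :=
      fun w hw => hw.2
    have hvm : v ∈ RB n k s \ {w | (graphA n).Adj v w} :=
      ⟨by simp only [RB, Set.mem_ofPred_eq]; omega, (graphA n).loopless.irrefl _⟩
    by_cases h1 : k = 1
    · subst h1
      exact Good.iso v hvm hviso (Good.zero _)
    · have : (RB n k s \ {w | (graphA n).Adj v w}) \ {v} = RB n (k - 2) (!s) := by
        ext x
        simp only [RB, Set.mem_ofPred_eq, Set.mem_sdiff, Set.mem_singleton_iff, vext, adjA]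
        cases s <;> cases hx : sd x <;> simp_all <;> omega
      refine Good.mono (r := ((k - 2) / 2 + 1) + 1) ?_ (by omega)
      refine Good.iso v hvm hviso ?_
      rw [this]
      exact ih _ (by omega) (by omega) _

lemma good_univ (hn : 2 ≤ n) : Good (graphA n) Set.univ ((n + 1) / 2) := by
  obtain ⟨v, hv, hvs⟩ := vexists (n := n) (n - 1) (by omega) true
  refine Good.split v (Set.mem_univ _) ?_ ?_
  · have : (Set.univ \ {v}) = RB n (n - 1) false := by
      ext x
      have := col_lt x
      simp only [RB, Set.mem_ofPred_eq, Set.mem_sdiff, Set.mem_singleton_iff, vext, Set.mem_univ]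
      cases hx : sd x <;> simp_all <;> omega
    rw [this]
    exact (good_RB (n - 1) (by omega) false).mono (by omega)
  · refine Good.mono (r := ((n - 2) / 2 + 1) + 1) ?_ (by omega)
    refine Good.iso v ⟨Set.mem_univ _, (graphA n).loopless.irrefl _⟩ (fun w hw => hw.2) ?_
    have : (Set.univ \ {w | (graphA n).Adj v w}) \ {v} = RB n (n - 2) false := by
      ext x
      have := col_lt x
      simp only [RB, Set.mem_ofPred_eq, Set.mem_sdiff, Set.mem_singleton_iff, vext, Set.mem_univ,
        adjA]
      cases hx : sd x <;> simp_all <;> omega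
    rw [this]
    exact good_RB (n - 2) (by omega) false

/-- even columns from `2 * k` on -/
def WT (n k : ℕ) : Set (Fin n ⊕ Fin n) := {v | col v % 2 = 0 ∧ 2 * k ≤ col v}

/-- even columns from `2 * k` on, minus one vertex of column `2 * k` -/
def WTa (n k : ℕ) (s : Bool) : Set (Fin n ⊕ Fin n) :=
  {v | col v % 2 = 0 ∧ 2 * k ≤ col v ∧ ¬ (col v = 2 * k ∧ sd v = s)}

lemma good_WTa_of (k m : ℕ) (hk : 2 * k < n) (s : Bool) (h : Good (graphA n) (WT n (k + 1)) m) :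
    Good (graphA n) (WTa n k s) (m + 1) := by
  obtain ⟨v, hv, hvs⟩ := vexists (n := n) (2 * k) hk (!s)
  refine Good.iso v ?_ ?_ ?_
  · simp [WTa, hv, hvs]
  · intro w hw
    simp only [WTa, Set.mem_ofPred_eq] at hw
    rw [adjA]
    cases s <;> cases hx : sd w <;> simp_all <;> omega
  · have : WTa n k s \ {v} = WT n (k + 1) := by
      ext x
      simp only [WT, WTa, Set.mem_ofPred_eq, Set.mem_sdiff, Set.mem_singleton_iff, vext]
      cases s <;> cases hx : sd x <;> simp_all <;> omega
    rw [this]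
    exact h

lemma good_WT (m : ℕ) : ∀ k, k + m = (n + 1) / 2 → Good (graphA n) (WT n k) m := by
  induction m with
  | zero => intro k _; exact Good.zero _
  | succ m ih =>
    intro k hk
    have h := ih (k + 1) (by omega)
    obtain ⟨v, hv, hvs⟩ := vexists (n := n) (2 * k) (by omega) true
    refine Good.split v ?_ ?_ ?_
    · simp [WT, hv]
    · have : WT n k \ {v} = WTa n k true := by
        ext x
        simp only [WT, WTa, Set.mem_ofPred_eq, Set.mem_sdiff, Set.mem_singleton_iff, vext]
        cases hx : sd x <;> simp_all <;> omega
      rw [this]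
      exact good_WTa_of k m (by omega) true h
    · have : WT n k \ {w | (graphA n).Adj v w} = WTa n k false := by
        ext x
        simp only [WT, WTa, Set.mem_ofPred_eq, Set.mem_sdiff, adjA]
        cases hx : sd x <;> simp_all <;> omega
      rw [this]
      exact good_WTa_of k m (by omega) false h

lemma good_WTa (k m : ℕ) (hk : k + (m + 1) = (n + 1) / 2) (s : Bool) :
    Good (graphA n) (WTa n k s) (m + 1) :=
  good_WTa_of k m (by omega) s (good_WT m (k + 1) (by omega))

/-- the colour class inside a block of two columns -/
def clr (v : Fin n ⊕ Fin n) : Bool := if col v % 2 = 0 then sd v else !(sd v)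

/-- faces of the join of blocks `≥ k` -/
def dM (n k : ℕ) : Set (Finset (Fin n ⊕ Fin n)) :=
  {σ | (∀ v ∈ σ, k ≤ col v / 2) ∧ ∀ v ∈ σ, ∀ w ∈ σ, col v / 2 = col w / 2 → clr v = clr w}

/-- faces of the join of blocks `≥ k` missing one colour class in block `k` -/
def dMa (n k : ℕ) (s : Bool) : Set (Finset (Fin n ⊕ Fin n)) :=
  {σ | σ ∈ dM n k ∧ ∀ v ∈ σ, ¬ (col v / 2 = k ∧ clr v = s)}

lemma dM_isComplex (k : ℕ) : IsComplex (dM n k) := fun _ hσ _ h =>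
  ⟨fun v hv => hσ.1 v (h hv), fun v hv w hw => hσ.2 v (h hv) w (h hw)⟩

lemma dMa_isComplex (k : ℕ) (s : Bool) : IsComplex (dMa n k s) := fun _ hσ _ h =>
  ⟨dM_isComplex k _ hσ.1 _ h, fun v hv => hσ.2 v (h hv)⟩

lemma dM_union (k : ℕ) : dM n k = dMa n k true ∪ dMa n k false := by
  ext σ
  constructor
  · intro h
    by_cases hh : ∃ v ∈ σ, col v / 2 = k ∧ clr v = true
    · obtain ⟨v, hv, h1, h2⟩ := hh
      refine Or.inr ⟨h, ?_⟩
      rintro w hw ⟨h3, h4⟩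
      have := h.2 v hv w hw (by omega)
      rw [h2, h4] at this
      exact absurd this (by decide)
    · push Not at hh
      exact Or.inl ⟨h, fun v hv h' => hh v hv h'.1 h'.2⟩
  · rintro (h | h) <;> exact h.1

lemma dM_inter (k : ℕ) : dM n (k + 1) = dMa n k true ∩ dMa n k false := by
  ext σ
  constructor
  · intro h
    have h0 : σ ∈ dM n k := ⟨fun v hv => by have := h.1 v hv; omega, h.2⟩
    exact ⟨⟨h0, fun v hv h' => by have := h.1 v hv; omega⟩,
      ⟨h0, fun v hv h' => by have := h.1 v hv; omega⟩⟩
  · rintro ⟨⟨h1, h2⟩, ⟨_, h3⟩⟩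
    refine ⟨fun v hv => ?_, h1.2⟩
    have a1 := h1.1 v hv
    have a2 := h2 v hv
    have a3 := h3 v hv
    cases hc : clr v
    · simp only [hc, and_true] at a3; omega
    · simp only [hc, and_true] at a2; omega

lemma ind_WT_union (k : ℕ) : ind (graphA n) (WT n k) =
    ind (graphA n) (WTa n k true) ∪ ind (graphA n) (WTa n k false) := by
  ext σ
  constructor
  · intro h
    by_cases hh : ∃ v ∈ σ, col v = 2 * k ∧ sd v = true
    · obtain ⟨v, hv, h1, h2⟩ := hh
      refine Or.inr ⟨fun w hw => ?_, h.2⟩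
      have a := h.1 w hw
      have b := h.2 v hv w hw
      rw [adjA] at b
      simp only [WT, WTa, Set.mem_ofPred_eq] at a ⊢
      refine ⟨a.1, a.2, ?_⟩
      rintro ⟨h3, h4⟩
      apply b
      right
      rw [h2, h4, h1, h3]
      simp
    · push Not at hh
      refine Or.inl ⟨fun v hv => ?_, h.2⟩
      have a := h.1 v hv
      exact ⟨a.1, a.2, fun h' => hh v hv h'.1 h'.2⟩
  · rintro (h | h) <;> exact ⟨fun v hv => ⟨(h.1 v hv).1, (h.1 v hv).2.1⟩, h.2⟩

lemma ind_WT_inter (k : ℕ) : ind (graphA n) (WT n (k + 1)) =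
    ind (graphA n) (WTa n k true) ∩ ind (graphA n) (WTa n k false) := by
  ext σ
  constructor
  · intro h
    constructor
    all_goals
      refine ⟨fun v hv => ?_, h.2⟩
      have a := h.1 v hv
      simp only [WT, WTa, Set.mem_ofPred_eq] at a ⊢
      omega
  · rintro ⟨h1, h2⟩
    refine ⟨fun v hv => ?_, h1.2⟩
    have a := h1.1 v hv
    have b := h2.1 v hv
    simp only [WT, WTa, Set.mem_ofPred_eq] at a b ⊢
    cases hc : sd v <;> simp only [hc] at a b <;> simp at a b <;> omega

lemma adj_of_clr {v w : Fin n ⊕ Fin n} (h : col v / 2 = col w / 2) (hc : clr v ≠ clr w) :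
    (graphA n).Adj v w := by
  rw [adjA]
  unfold clr at hc
  cases hv : sd v <;> cases hw : sd w <;> simp [hv, hw] at hc ⊢ <;> omega

lemma ind_univ_le : ind (graphA n) Set.univ ⊆ dM n 0 := by
  intro σ h
  refine ⟨fun v _ => Nat.zero_le _, fun v hv w hw e => ?_⟩
  by_contra hc
  exact h.2 v hv w hw (adj_of_clr e hc)

lemma ind_WT_le (k : ℕ) : ind (graphA n) (WT n k) ⊆ dM n k := by
  intro σ h
  refine ⟨fun v hv => ?_, fun v hv w hw e => ?_⟩
  · have := (h.1 v hv).2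
    omega
  · by_contra hc
    exact h.2 v hv w hw (adj_of_clr e hc)

lemma ind_WTa_le (k : ℕ) (s : Bool) : ind (graphA n) (WTa n k s) ⊆ dMa n k s := by
  intro σ h
  refine ⟨ind_WT_le k ⟨fun v hv => ⟨(h.1 v hv).1, (h.1 v hv).2.1⟩, h.2⟩, ?_⟩
  rintro v hv ⟨h1, h2⟩
  obtain ⟨a, b, c⟩ := h.1 v hv
  unfold clr at h2
  rw [if_pos a] at h2
  exact c ⟨by omega, h2⟩

lemma ind_mono {V : Type} (G : SimpleGraph V) {R R' : Set V} (h : R ⊆ R') : ind G R ⊆ ind G R' :=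
  fun _ hσ => ⟨fun i hi => h (hσ.1 i hi), hσ.2⟩

lemma mem_dM_top (σ : Finset (Fin n ⊕ Fin n)) (h : σ ∈ dM n ((n + 1) / 2)) : σ = ∅ := by
  rw [Finset.eq_empty_iff_forall_notMem]
  intro v hv
  have := h.1 v hv
  have := col_lt v
  omega

end LadderCombinatorics

section StanleyReisner

universe u

variable {V : Type} [DecidableEq V] {K : Type u} [Field K]

/-- The Stanley–Reisner ideal of a family of faces. -/
noncomputable def srIdeal (K : Type u) [Field K] (Δ : Set (Finset V)) :
    Ideal (MvPolynomial V K) :=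
  Ideal.span ((fun s => monomial s (1 : K)) '' {a : V →₀ ℕ | a.support ∉ Δ})

lemma mem_srIdeal {Δ : Set (Finset V)} (hΔ : IsComplex Δ) (p : MvPolynomial V K) :
    p ∈ srIdeal K Δ ↔ ∀ a ∈ p.support, a.support ∉ Δ := by
  rw [srIdeal, mem_ideal_span_monomial_image]
  constructor
  · intro h a ha h'
    obtain ⟨b, hb, hle⟩ := h a ha
    exact hb (hΔ _ h' _ (Finsupp.support_mono hle))
  · intro h a ha
    exact ⟨a, h a ha, le_rfl⟩

lemma monomial_mem_srIdeal {Δ : Set (Finset V)} {a : V →₀ ℕ} (h : a.support ∉ Δ) (c : K) :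
    monomial a c ∈ srIdeal K Δ := by
  have : monomial a c = C c * monomial a (1 : K) := by simp [C_mul_monomial]
  rw [this]
  exact Ideal.mul_mem_left _ _ (Ideal.subset_span ⟨a, h, rfl⟩)

lemma srIdeal_le_of {Δ : Set (Finset V)} {I : Ideal (MvPolynomial V K)}
    (h : ∀ a : V →₀ ℕ, a.support ∉ Δ → monomial a (1 : K) ∈ I) : srIdeal K Δ ≤ I := by
  rw [srIdeal, Ideal.span_le]
  rintro _ ⟨a, ha, rfl⟩
  exact h a ha

lemma srIdeal_anti {Δ Δ' : Set (Finset V)} (h : Δ ⊆ Δ') : srIdeal K Δ' ≤ srIdeal K Δ :=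
  srIdeal_le_of fun _ ha => monomial_mem_srIdeal (fun h' => ha (h h')) 1

lemma edgeIdeal_eq (G : SimpleGraph V) : edgeIdeal K G = srIdeal K (ind G Set.univ) := by
  apply le_antisymm
  · rw [edgeIdeal, Ideal.span_le]
    rintro _ ⟨i, j, hij, rfl⟩
    have : (X i * X j : MvPolynomial V K) =
        monomial (Finsupp.single i 1 + Finsupp.single j 1) 1 := by
      simp [X, monomial_mul]
    rw [this]
    refine monomial_mem_srIdeal (fun h => ?_) 1
    refine h.2 i ?_ j ?_ hij <;> simp [supp_add]
  · refine srIdeal_le_of fun a ha => ?_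
    have : ∃ i ∈ a.support, ∃ j ∈ a.support, G.Adj i j := by
      by_contra hc
      push Not at hc
      exact ha ⟨fun _ _ => Set.mem_univ _, hc⟩
    obtain ⟨i, hi, j, hj, hij⟩ := this
    obtain ⟨b, rfl⟩ := exists_single_add (Finsupp.mem_support_iff.1 hi)
    have hj' : b j ≠ 0 := by
      rw [Finsupp.mem_support_iff, Finsupp.add_apply, Finsupp.single_apply, if_neg hij.ne,
        zero_add] at hj
      exact hj
    obtain ⟨c, rfl⟩ := exists_single_add hj'
    have : (monomial (Finsupp.single i 1 + (Finsupp.single j 1 + c)) 1 : MvPolynomial V K) =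
        monomial c 1 * (X i * X j) := by
      simp only [X, monomial_mul, one_mul]
      rw [add_comm c, add_assoc]
    rw [this]
    exact Ideal.mul_mem_left _ _ (Ideal.subset_span ⟨i, j, hij, rfl⟩)

lemma linInd_srIdeal {Δ : Set (Finset V)} (hΔ : IsComplex Δ) :
    LinearIndependent K (fun a : {a : V →₀ ℕ // a.support ∈ Δ} =>
      Ideal.Quotient.mk (srIdeal K Δ) (monomial a.1 (1 : K))) := by
  have h1 : LinearIndependent K (fun a : {a : V →₀ ℕ // a.support ∈ Δ} =>
      (monomial a.1 (1 : K) : MvPolynomial V K)) := by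
    have := (basisMonomials V K).linearIndependent.comp
      (fun a : {a : V →₀ ℕ // a.support ∈ Δ} => a.1) Subtype.val_injective
    simpa [Function.comp_def] using this
  refine h1.map (f := (Ideal.Quotient.mkₐ K (srIdeal K Δ)).toLinearMap) ?_
  rw [Submodule.disjoint_def]
  intro p hp hker
  have hI : p ∈ srIdeal K Δ := by
    rw [LinearMap.mem_ker] at hker
    exact Ideal.Quotient.eq_zero_iff_mem.1 hker
  rw [mem_srIdeal hΔ] at hI
  have hs : ∀ a ∈ p.support, a.support ∈ Δ := by
    clear hker hI
    induction hp using Submodule.span_induction with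
    | mem x hx =>
      obtain ⟨a, rfl⟩ := hx
      intro b hb
      have := support_monomial_subset hb
      rw [Finset.mem_singleton] at this
      rw [this]; exact a.2
    | zero => simp
    | add x y _ _ hx hy =>
      intro a ha
      rcases Finset.mem_union.1 (support_add ha) with h | h
      · exact hx a h
      · exact hy a h
    | smul c x _ hx =>
      intro a ha
      exact hx a (support_smul ha)
  rw [← support_eq_empty, Finset.eq_empty_iff_forall_notMem]
  intro a ha
  exact hI a ha (hs a ha)

lemma HasPart.exists_decomp {Δ : Set (Finset V)} (hΔ : IsComplex Δ) {r : ℕ} (h : HasPart Δ r) :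
    ∃ D : StanleyDecomposition (srIdeal K Δ), ∀ j, r ≤ (D.Z j).card := by
  obtain ⟨ι, _, u, Z, h1, h2, h3, h4⟩ := h
  let e := (Fintype.equivFin ι).symm
  have hli := linInd_srIdeal (K := K) hΔ
  set B : {a : V →₀ ℕ // a.support ∈ Δ} → MvPolynomial V K ⧸ srIdeal K Δ :=
    (fun a => Ideal.Quotient.mk (srIdeal K Δ) (monomial a.1 (1 : K))) with hB
  let s : Fin (Fintype.card ι) → Set {a : V →₀ ℕ // a.support ∈ Δ} := fun j =>
    {a | ∃ b : V →₀ ℕ, b.support ⊆ Z (e j) ∧ a.1 = u (e j) + b}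
  have hsp : ∀ j, stanleySpace (srIdeal K Δ) (u (e j)) (Z (e j)) =
      Submodule.span K (B '' s j) := by
    intro j
    unfold stanleySpace
    congr 1
    ext x
    constructor
    · rintro ⟨a, ha, rfl⟩
      exact ⟨⟨_, h3 (e j) a ha⟩, ⟨a, ha, rfl⟩, rfl⟩
    · rintro ⟨⟨a, haΔ⟩, ⟨b, hb, hab⟩, rfl⟩
      refine ⟨b, hb, ?_⟩
      simp only at hab
      simp only [hB, hab]
  refine ⟨⟨Fintype.card ι, fun j => u (e j), fun j => Z (e j), ?_, ?_⟩, fun j => h1 (e j)⟩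
  · intro j
    have := hli.comp (fun a : {a : V →₀ ℕ // a.support ⊆ Z (e j)} =>
      (⟨u (e j) + a.1, h3 (e j) a.1 a.2⟩ : {a : V →₀ ℕ // a.support ∈ Δ})) (by
        intro a b hab
        have := congrArg Subtype.val hab
        exact Subtype.ext (add_left_cancel this))
    exact this
  · simp only [hsp]
    rw [DirectSum.isInternal_submodule_iff_iSupIndep_and_iSup_eq_top]
    constructor
    · intro j
      have hd : Disjoint (s j) (s j)ᶜ := disjoint_compl_right
      refine (hli.disjoint_span_image hd).mono_right ?_
      refine iSup₂_le fun i hij => Submodule.span_mono (Set.image_mono ?_)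
      rintro a ⟨b, hb, hab⟩ ⟨b', hb', hab'⟩
      apply hij
      exact e.injective (h4 _ _ b b' hb hb' (hab.symm.trans hab'))
    · rw [eq_top_iff]
      rintro x -
      obtain ⟨p, rfl⟩ := Ideal.Quotient.mk_surjective x
      induction p using MvPolynomial.induction_on' with
      | add p q hp hq => rw [map_add]; exact Submodule.add_mem _ hp hq
      | monomial a c =>
        by_cases ha : a.support ∈ Δ
        · obtain ⟨j, b, hb, hab⟩ := h2 a ha
          have e1 : Ideal.Quotient.mk (srIdeal K Δ) (monomial a c) = c • B ⟨a, ha⟩ := by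
            have : (monomial a c : MvPolynomial V K) = c • monomial a 1 := by
              rw [smul_monomial, smul_eq_mul, mul_one]
            rw [this]
            exact map_smul (Ideal.Quotient.mkₐ K (srIdeal K Δ)) c (monomial a 1)
          rw [e1]
          refine Submodule.smul_mem _ _ ?_
          refine Submodule.mem_iSup_of_mem (e.symm j) (Submodule.subset_span ⟨_, ?_, rfl⟩)
          exact ⟨b, by simpa using hb, by simpa using hab⟩
        · rw [Ideal.Quotient.eq_zero_iff_mem.2 (monomial_mem_srIdeal ha c)]
          exact Submodule.zero_mem _

end StanleyReisner

section ExtLemmas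

universe u

variable {R : Type u} [CommRing R]

/-- cyclic module -/
noncomputable abbrev cyc (I : Ideal R) : ModuleCat.{u} R := ModuleCat.of R (R ⧸ I)

/-- projection between cyclic modules -/
noncomputable abbrev fac {I J : Ideal R} (h : I ≤ J) : cyc I ⟶ cyc J :=
  ModuleCat.ofHom (Submodule.factor h)

lemma ext_mid {S : ShortComplex (ModuleCat.{u} R)} (hS : S.ShortExact) (N : ModuleCat.{u} R)
    (i : ℕ) (h1 : Subsingleton (Ext N S.X₁ i)) (h3 : Subsingleton (Ext N S.X₃ i)) :
    Subsingleton (Ext N S.X₂ i) := by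
  refine subsingleton_of_forall_eq 0 fun x => ?_
  obtain ⟨y, rfl⟩ := Ext.covariant_sequence_exact₂ N hS x (Subsingleton.elim _ _)
  rw [Subsingleton.elim y 0, Ext.zero_comp]

lemma ext_prod (N : ModuleCat.{u} R) (A B : Ideal R) (i : ℕ)
    (h1 : Subsingleton (Ext N (cyc A) i)) (h3 : Subsingleton (Ext N (cyc B) i)) :
    Subsingleton (Ext N (ModuleCat.of R ((R ⧸ A) × (R ⧸ B))) i) := by
  let S : ShortComplex (ModuleCat.{u} R) :=
    ShortComplex.mk (ModuleCat.ofHom (LinearMap.inl R (R ⧸ A) (R ⧸ B)))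
      (ModuleCat.ofHom (LinearMap.snd R (R ⧸ A) (R ⧸ B))) (by
        ext; rfl)
  have hS : S.ShortExact := ModuleCat.shortComplex_shortExact S
    (Function.Exact.inl_snd) LinearMap.inl_injective LinearMap.snd_surjective
  exact ext_mid hS N i h1 h3

/-- the colon sequence -/
noncomputable abbrev colonSeq (J I L : Ideal R) (f : R) (hJ : ∀ p, p ∈ J ↔ f * p ∈ I)
    (hL : L = I ⊔ Ideal.span {f}) : ShortComplex (ModuleCat.{u} R) :=
  ShortComplex.mk (X₁ := cyc J) (X₂ := cyc I) (X₃ := cyc L)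
    (ModuleCat.ofHom (Submodule.mapQ J I (LinearMap.lsmul R R f) (fun p hp => (hJ p).1 hp)))
    (fac (hL ▸ le_sup_left)) (by
      refine ModuleCat.hom_ext (LinearMap.ext fun x => ?_)
      obtain ⟨x, rfl⟩ := Submodule.mkQ_surjective _ x
      change Submodule.Quotient.mk (f * x) = 0
      rw [Submodule.Quotient.mk_eq_zero, hL]
      exact Ideal.mem_sup_right (Ideal.mul_mem_right _ _ (Ideal.mem_span_singleton_self f)))

lemma colonSeq_exact (J I L : Ideal R) (f : R) (hJ : ∀ p, p ∈ J ↔ f * p ∈ I)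
    (hL : L = I ⊔ Ideal.span {f}) : (colonSeq J I L f hJ hL).ShortExact := by
  refine ModuleCat.shortComplex_shortExact _ ?_ ?_ ?_
  · intro y
    constructor
    · intro h
      obtain ⟨y, rfl⟩ := Submodule.Quotient.mk_surjective _ y
      have h : (Submodule.Quotient.mk y : R ⧸ L) = 0 := h
      rw [Submodule.Quotient.mk_eq_zero, hL, Submodule.mem_sup] at h
      obtain ⟨a, ha, b, hb, rfl⟩ := h
      obtain ⟨c, rfl⟩ := Ideal.mem_span_singleton'.1 hb
      refine ⟨Submodule.Quotient.mk c, ?_⟩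
      change (Submodule.Quotient.mk (f * c) : R ⧸ I) = Submodule.Quotient.mk (a + c * f)
      rw [Submodule.Quotient.eq]
      have : f * c - (a + c * f) = - a := by ring
      rw [this]
      exact I.neg_mem ha
    · rintro ⟨x, rfl⟩
      obtain ⟨x, rfl⟩ := Submodule.Quotient.mk_surjective _ x
      change (Submodule.Quotient.mk (f * x) : R ⧸ L) = 0
      rw [Submodule.Quotient.mk_eq_zero, hL]
      exact Ideal.mem_sup_right (Ideal.mul_mem_right _ _ (Ideal.mem_span_singleton_self f))
  · refine (injective_iff_map_eq_zero (Submodule.mapQ J I (LinearMap.lsmul R R f)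
      (fun p hp => (hJ p).1 hp))).2 ?_
    intro x hx
    obtain ⟨x, rfl⟩ := Submodule.Quotient.mk_surjective _ x
    have hx : (Submodule.Quotient.mk (f * x) : R ⧸ I) = 0 := hx
    rw [Submodule.Quotient.mk_eq_zero] at hx
    rw [Submodule.Quotient.mk_eq_zero]
    exact (hJ x).2 hx
  · exact Submodule.factor_surjective (hL ▸ le_sup_left : I ≤ L)

lemma ext_iso (N : ModuleCat.{u} R) (I L : Ideal R) (f : R) (hJ : ∀ p, p ∈ I ↔ f * p ∈ I)
    (hL : L = I ⊔ Ideal.span {f}) (hf : f ∈ Module.annihilator R N) (r : ℕ)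
    (h : ∀ i < r, Subsingleton (Ext N (cyc L) i)) :
    ∀ i < r + 1, Subsingleton (Ext N (cyc I) i) := by
  have hS := colonSeq_exact I I L f hJ hL
  have hid : (colonSeq I I L f hJ hL).f = f • 𝟙 (cyc I) := by
    refine ModuleCat.hom_ext (LinearMap.ext fun x => ?_)
    obtain ⟨x, rfl⟩ := Submodule.mkQ_surjective _ x
    rfl
  have h0 : ∀ i (x : Ext N (cyc I) i),
      x.comp (Ext.mk₀ (colonSeq I I L f hJ hL).f) (add_zero i) = 0 := by
    intro i x
    rw [hid]
    have := Ext.postcomp_smul_id_eq_zero_of_mem_annihilator (M := cyc I) hf i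
    exact congrArg (fun φ => φ.hom x) this
  intro i hi
  refine subsingleton_of_forall_eq 0 fun x => ?_
  cases i with
  | zero =>
    have := hS.mono_f
    apply Ext.postcomp_mk₀_injective_of_mono N (colonSeq I I L f hJ hL).f
    exact (h0 0 x).trans (map_zero _).symm
  | succ i =>
    obtain ⟨y, hy⟩ := Ext.covariant_sequence_exact₁ N hS x (h0 _ x) rfl
    have := h i (by omega)
    have hy0 : y = 0 := Subsingleton.elim (α := Ext N (cyc L) i) _ _
    exact hy.symm.trans ((congrArg (fun t => Ext.comp t hS.extClass rfl) hy0).trans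
      (Ext.zero_comp _ _ _ _ _))

/-- the Mayer–Vietoris sequence -/
noncomputable abbrev mv (I A B L : Ideal R) (hA : I ≤ A) (hB : I ≤ B) (hAL : A ≤ L) (hBL : B ≤ L) :
    ShortComplex (ModuleCat.{u} R) :=
  ShortComplex.mk (X₁ := cyc I) (X₂ := ModuleCat.of R ((R ⧸ A) × (R ⧸ B))) (X₃ := cyc L)
    (ModuleCat.ofHom ((Submodule.factor hA).prod (Submodule.factor hB)))
    (ModuleCat.ofHom ((Submodule.factor hAL).comp (LinearMap.fst R _ _) -
      (Submodule.factor hBL).comp (LinearMap.snd R _ _))) (by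
      refine ModuleCat.hom_ext (LinearMap.ext fun x => ?_)
      obtain ⟨x, rfl⟩ := Submodule.mkQ_surjective _ x
      change (Submodule.Quotient.mk x : R ⧸ L) - Submodule.Quotient.mk x = 0
      rw [sub_self])

lemma mv_exact (I A B L : Ideal R) (hA : I ≤ A) (hB : I ≤ B) (hAL : A ≤ L) (hBL : B ≤ L)
    (hI : A ⊓ B ≤ I) (hL : L ≤ A ⊔ B) : (mv I A B L hA hB hAL hBL).ShortExact := by
  refine ModuleCat.shortComplex_shortExact _ ?_ ?_ ?_
  · rintro ⟨y, z⟩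
    obtain ⟨y, rfl⟩ := Submodule.Quotient.mk_surjective _ y
    obtain ⟨z, rfl⟩ := Submodule.Quotient.mk_surjective _ z
    constructor
    · intro h
      have h : (Submodule.Quotient.mk y : R ⧸ L) - Submodule.Quotient.mk z = 0 := h
      rw [sub_eq_zero, Submodule.Quotient.eq] at h
      obtain ⟨a, ha, b, hb, hab⟩ := Submodule.mem_sup.1 (hL h)
      refine ⟨Submodule.Quotient.mk (y - a), ?_⟩
      change ((Submodule.Quotient.mk (y - a) : R ⧸ A), (Submodule.Quotient.mk (y - a) : R ⧸ B)) = _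
      refine Prod.ext ?_ ?_
      · refine (Submodule.Quotient.eq A).2 ?_
        have : y - a - y = -a := by ring
        rw [this]; exact A.neg_mem ha
      · refine (Submodule.Quotient.eq B).2 ?_
        have : y - a - z = b := by linear_combination -hab
        rw [this]; exact hb
    · rintro ⟨x, hx⟩
      obtain ⟨x, rfl⟩ := Submodule.Quotient.mk_surjective _ x
      rw [← hx]
      change (Submodule.Quotient.mk x : R ⧸ L) - Submodule.Quotient.mk x = 0
      rw [sub_self]
  · refine (injective_iff_map_eq_zero
      ((Submodule.factor hA).prod (Submodule.factor hB))).2 ?_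
    intro x hx
    obtain ⟨x, rfl⟩ := Submodule.Quotient.mk_surjective _ x
    have h1 : (Submodule.Quotient.mk x : R ⧸ A) = 0 := congrArg Prod.fst hx
    have h2 : (Submodule.Quotient.mk x : R ⧸ B) = 0 := congrArg Prod.snd hx
    rw [Submodule.Quotient.mk_eq_zero] at h1 h2 ⊢
    exact hI ⟨h1, h2⟩
  · intro x
    obtain ⟨x, rfl⟩ := Submodule.Quotient.mk_surjective _ x
    refine ⟨(Submodule.Quotient.mk x, 0), ?_⟩
    change (Submodule.Quotient.mk x : R ⧸ L) - Submodule.factor hBL 0 = _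
    rw [map_zero, sub_zero]

/-- naturality of the Mayer–Vietoris sequence -/
noncomputable def mvHom (I A B L : Ideal R) (hA : I ≤ A) (hB : I ≤ B) (hAL : A ≤ L) (hBL : B ≤ L)
    (I' A' B' L' : Ideal R) (hA' : I' ≤ A') (hB' : I' ≤ B') (hAL' : A' ≤ L') (hBL' : B' ≤ L')
    (hi : I ≤ I') (ha : A ≤ A') (hb : B ≤ B') (hl : L ≤ L') :
    mv I A B L hA hB hAL hBL ⟶ mv I' A' B' L' hA' hB' hAL' hBL' where
  τ₁ := fac hi
  τ₂ := ModuleCat.ofHom (LinearMap.prodMap (Submodule.factor ha) (Submodule.factor hb))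
  τ₃ := fac hl
  comm₁₂ := by
    refine ModuleCat.hom_ext (LinearMap.ext fun x => ?_)
    obtain ⟨x, rfl⟩ := Submodule.mkQ_surjective _ x
    rfl
  comm₂₃ := by
    refine ModuleCat.hom_ext (LinearMap.ext fun x => ?_)
    obtain ⟨y, z⟩ := x
    obtain ⟨y, rfl⟩ := Submodule.mkQ_surjective _ y
    obtain ⟨z, rfl⟩ := Submodule.mkQ_surjective _ z
    rfl

lemma mv_step (N : ModuleCat.{u} R)
    (I A B L : Ideal R) (hA : I ≤ A) (hB : I ≤ B) (hAL : A ≤ L) (hBL : B ≤ L)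
    (hI : A ⊓ B ≤ I) (hL : L ≤ A ⊔ B)
    (I' A' B' L' : Ideal R) (hA' : I' ≤ A') (hB' : I' ≤ B') (hAL' : A' ≤ L') (hBL' : B' ≤ L')
    (hI' : A' ⊓ B' ≤ I') (hL' : L' ≤ A' ⊔ B')
    (hi : I ≤ I') (ha : A ≤ A') (hb : B ≤ B') (hl : L ≤ L') (m : ℕ)
    (h1 : Subsingleton (Ext N (cyc A') m)) (h2 : Subsingleton (Ext N (cyc B') m))
    (hx : ∃ x : Ext N (cyc L) m, x.comp (Ext.mk₀ (fac hl)) (add_zero m) ≠ 0) :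
    ∃ y : Ext N (cyc I) (m + 1), y.comp (Ext.mk₀ (fac hi)) (add_zero (m + 1)) ≠ 0 := by
  obtain ⟨x, hx⟩ := hx
  have e1 := mv_exact I A B L hA hB hAL hBL hI hL
  have e2 := mv_exact I' A' B' L' hA' hB' hAL' hBL' hI' hL'
  have nat := ShortComplex.ShortExact.extClass_naturality e1 e2
    (mvHom I A B L hA hB hAL hBL I' A' B' L' hA' hB' hAL' hBL' hi ha hb hl)
  have hx' : (x.comp (Ext.mk₀ (fac hl)) (add_zero m) : Ext N (cyc L') m).comp e2.extClass
      (rfl : m + 1 = m + 1) ≠ 0 := by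
    intro h0
    obtain ⟨z, hz⟩ := Ext.covariant_sequence_exact₃ N e2 _ rfl h0
    have := ext_prod N A' B' m h1 h2
    have hz0 : z = 0 :=
      Subsingleton.elim (α := Ext N (ModuleCat.of R ((R ⧸ A') × (R ⧸ B'))) m) _ _
    apply hx
    exact hz.symm.trans ((congrArg (fun t => Ext.comp t (Ext.mk₀ _) (add_zero m)) hz0).trans
      (Ext.zero_comp _ _ _ _ _))
  refine ⟨x.comp e1.extClass (rfl : m + 1 = m + 1), ?_⟩
  intro h0
  apply hx'
  have a1 := Ext.comp_assoc x e1.extClass (Ext.mk₀ (fac hi)) (rfl : m + 1 = m + 1) (add_zero 1)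
    (by omega : m + 1 + 0 = m + 1)
  have a2 := Ext.comp_assoc x (Ext.mk₀ (fac hl)) e2.extClass (add_zero m) (zero_add 1)
    (by omega : m + 0 + 1 = m + 1)
  exact (a2.trans ((congrArg (fun t => x.comp t (rfl : m + 1 = m + 1)) nat.symm).trans
    a1.symm)).trans h0

end ExtLemmas

section Final

open MvPolynomial

universe u

section General

variable {V : Type} [DecidableEq V] {K : Type u} [Field K]

lemma X_mul_mem (G : SimpleGraph V) (R : Set V) (v : V) (hv : v ∈ R) (p : MvPolynomial V K) :
    p ∈ srIdeal K (ind G (R \ {w | G.Adj v w})) ↔ X v * p ∈ srIdeal K (ind G R) := by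
  rw [mem_srIdeal (ind_isComplex _ _), mem_srIdeal (ind_isComplex _ _)]
  have hs : (X v * p).support = p.support.map (addLeftEmbedding (Finsupp.single v 1)) :=
    support_X_mul v p
  rw [hs]
  simp only [Finset.mem_map, addLeftEmbedding_apply, forall_exists_index, and_imp,
    forall_apply_eq_imp_iff₂]
  refine forall₂_congr fun a _ => ?_
  rw [supp_single_add, mem_ind_insert G R v hv]

lemma srIdeal_del (G : SimpleGraph V) (R : Set V) (v : V) :
    srIdeal K (ind G (R \ {v})) = srIdeal K (ind G R) ⊔ Ideal.span {X v} := by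
  apply le_antisymm
  · refine srIdeal_le_of fun a ha => ?_
    by_cases h : v ∈ a.support
    · obtain ⟨b, rfl⟩ := exists_single_add (Finsupp.mem_support_iff.1 h)
      refine Ideal.mem_sup_right ?_
      have : monomial (Finsupp.single v 1 + b) (1 : K) = X v * monomial b 1 := by
        rw [X, monomial_mul, one_mul]
      rw [this]
      exact Ideal.mul_mem_right _ _ (Ideal.mem_span_singleton_self _)
    · refine Ideal.mem_sup_left (monomial_mem_srIdeal (fun h' => ha ?_) 1)
      exact (mem_ind_del G R v _).2 ⟨h', h⟩
  · refine sup_le (srIdeal_anti (ind_mono G Set.sdiff_subset)) ?_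
    rw [Ideal.span_singleton_le_iff_mem]
    refine monomial_mem_srIdeal (fun h => ?_) 1
    refine ((mem_ind_del G R v _).1 h).2 ?_
    simp

lemma Good.ext_van {G : SimpleGraph V} {R : Set V} {r : ℕ} (h : Good G R r)
    (N : ModuleCat.{u} (MvPolynomial V K))
    (hN : ∀ v : V, (X v : MvPolynomial V K) ∈ Module.annihilator (MvPolynomial V K) N) :
    ∀ i < r, Subsingleton (Ext N (cyc (srIdeal K (ind G R))) i) := by
  induction h with
  | zero R => intro i hi; omega
  | @split R r v hv h1 h2 ih1 ih2 =>
    intro i hi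
    exact ext_mid (colonSeq_exact _ _ _ (X v) (X_mul_mem G R v hv) (srIdeal_del G R v)) N i
      (ih2 i hi) (ih1 i hi)
  | @iso R r v hv hw h1 ih =>
    have hR : R \ {w | G.Adj v w} = R := by
      ext w
      exact ⟨fun h => h.1, fun h => ⟨h, hw w h⟩⟩
    have := X_mul_mem (K := K) G R v hv
    rw [hR] at this
    exact ext_iso N _ _ (X v) this (srIdeal_del G R v) (hN v) r ih

lemma srIdeal_inf_le {Δ Δ₁ Δ₂ : Set (Finset V)} (h : Δ = Δ₁ ∪ Δ₂) (h1 : IsComplex Δ₁)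
    (h2 : IsComplex Δ₂) : srIdeal K Δ₁ ⊓ srIdeal K Δ₂ ≤ srIdeal K Δ := by
  subst h
  rintro p ⟨hp1, hp2⟩
  have h12 : IsComplex (Δ₁ ∪ Δ₂) := by
    rintro σ (hσ | hσ) τ hτ
    · exact Or.inl (h1 σ hσ τ hτ)
    · exact Or.inr (h2 σ hσ τ hτ)
  rw [mem_srIdeal h12]
  have a1 := (mem_srIdeal h1 p).1 hp1
  have a2 := (mem_srIdeal h2 p).1 hp2
  rintro a ha (h | h)
  · exact a1 a ha h
  · exact a2 a ha h

lemma le_srIdeal_sup {Δ Δ₁ Δ₂ : Set (Finset V)} (h : Δ = Δ₁ ∩ Δ₂) :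
    srIdeal K Δ ≤ srIdeal K Δ₁ ⊔ srIdeal K Δ₂ := by
  subst h
  refine srIdeal_le_of fun a ha => ?_
  by_cases h1 : a.support ∈ Δ₁
  · exact Ideal.mem_sup_right (monomial_mem_srIdeal (fun h2 => ha ⟨h1, h2⟩) 1)
  · exact Ideal.mem_sup_left (monomial_mem_srIdeal h1 1)

lemma empty_mem_ind (G : SimpleGraph V) (R : Set V) : ∅ ∈ ind G R := by
  constructor <;> simp

lemma one_notMem {Δ : Set (Finset V)} (hΔ : IsComplex Δ) (h : ∅ ∈ Δ) :
    (1 : MvPolynomial V K) ∉ srIdeal K Δ := by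
  rw [mem_srIdeal hΔ]
  intro h'
  refine h' 0 ?_ ?_
  · simp
  · simpa using h

lemma maxIdeal_le {Δ : Set (Finset V)} (h : ∀ v, {v} ∉ Δ) :
    maxIdeal K V ≤ srIdeal K Δ := by
  rw [maxIdeal, Ideal.span_le]
  rintro _ ⟨v, rfl⟩
  refine monomial_mem_srIdeal (fun h' => h v ?_) 1
  rwa [Finsupp.support_single _ one_ne_zero] at h'

lemma le_maxIdeal {Δ : Set (Finset V)} (h : ∅ ∈ Δ) : srIdeal K Δ ≤ maxIdeal K V := by
  refine srIdeal_le_of fun a ha => ?_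
  have h1 : a.support.Nonempty := by
    rw [Finset.nonempty_iff_ne_empty]
    intro h'
    exact ha (h' ▸ h)
  obtain ⟨v, hv⟩ := h1
  obtain ⟨b, rfl⟩ := exists_single_add (Finsupp.mem_support_iff.1 hv)
  have : monomial (Finsupp.single v 1 + b) (1 : K) = X v * monomial b 1 := by
    rw [X, monomial_mul, one_mul]
  rw [this]
  exact Ideal.mul_mem_right _ _ (Ideal.subset_span ⟨v, rfl⟩)

lemma one_notMem_max : (1 : MvPolynomial V K) ∉ maxIdeal K V := by
  intro h
  refine one_notMem (K := K) (V := V) (Δ := {∅}) ?_ rfl (maxIdeal_le (fun v => ?_) h)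
  · rintro σ rfl τ hτ
    exact Finset.subset_empty.1 hτ
  · simp

lemma X_ann (v : V) : (X v : MvPolynomial V K) ∈
    Module.annihilator (MvPolynomial V K) (cyc (maxIdeal K V)) := by
  change _ ∈ Module.annihilator (MvPolynomial V K) (MvPolynomial V K ⧸ maxIdeal K V)
  rw [Ideal.annihilator_quotient]
  exact Ideal.subset_span ⟨v, rfl⟩

lemma supp_max : Module.support (MvPolynomial V K) (cyc (maxIdeal K V)) =
    PrimeSpectrum.zeroLocus (maxIdeal K V) := by
  change Module.support (MvPolynomial V K) (MvPolynomial V K ⧸ maxIdeal K V) = _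
  rw [Module.support_eq_zeroLocus, Ideal.annihilator_quotient]

lemma smul_lt {I : Ideal (MvPolynomial V K)} (h : I ≤ maxIdeal K V) :
    maxIdeal K V • (⊤ : Submodule (MvPolynomial V K) (cyc I)) < ⊤ := by
  rw [lt_top_iff_ne_top]
  intro h'
  have h1 : (maxIdeal K V • (⊤ : Submodule (MvPolynomial V K) (MvPolynomial V K ⧸ I))) ≤
      Submodule.map (Submodule.mkQ I) (maxIdeal K V) := by
    rw [Submodule.smul_le]
    intro r hr x _
    obtain ⟨x, rfl⟩ := Submodule.mkQ_surjective _ x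
    rw [← map_smul]
    exact Submodule.mem_map_of_mem (Ideal.mul_mem_right _ _ hr)
  have h2 : Submodule.mkQ I 1 ∈ Submodule.map (Submodule.mkQ I) (maxIdeal K V) := by
    apply h1
    have h4 : (⊤ : Submodule (MvPolynomial V K) (MvPolynomial V K ⧸ I)) ≤
        maxIdeal K V • ⊤ := h'.ge
    exact h4 Submodule.mem_top
  obtain ⟨y, hy, hy'⟩ := h2
  have h3 : y - 1 ∈ I := (Submodule.Quotient.eq I).1 hy'
  apply one_notMem_max (K := K) (V := V)
  have := (maxIdeal K V).sub_mem hy (h h3)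
  simpa using this

end General

variable {n : ℕ} {K : Type u} [Field K]

lemma nonvan (m : ℕ) : ∀ k, k + m = (n + 1) / 2 →
    ∃ x : Ext (cyc (maxIdeal K (Fin n ⊕ Fin n))) (cyc (srIdeal K (dM n k))) m,
      x.comp (Ext.mk₀ (fac (srIdeal_anti (ind_WT_le k)))) (add_zero m) ≠ 0 := by
  induction m with
  | zero =>
    intro k hk
    obtain rfl : k = (n + 1) / 2 := by omega
    have hle : maxIdeal K (Fin n ⊕ Fin n) ≤ srIdeal K (dM n ((n + 1) / 2)) :=
      maxIdeal_le fun v hv => Finset.singleton_ne_empty v (mem_dM_top _ hv)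
    refine ⟨Ext.mk₀ (fac hle), fun h0 => ?_⟩
    rw [Ext.mk₀_comp_mk₀] at h0
    have h1 := (Ext.mk₀_eq_zero_iff _).1 h0
    have h2 : (Submodule.Quotient.mk 1 : MvPolynomial (Fin n ⊕ Fin n) K ⧸
        srIdeal K (ind (graphA n) (WT n ((n + 1) / 2)))) = 0 :=
      congrArg (fun φ => φ.hom (Submodule.Quotient.mk 1)) h1
    rw [Submodule.Quotient.mk_eq_zero] at h2
    exact one_notMem (ind_isComplex _ _) (empty_mem_ind _ _) h2
  | succ m ih =>
    intro k hk
    exact mv_step _ (srIdeal K (dM n k)) (srIdeal K (dMa n k true)) (srIdeal K (dMa n k false))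
      (srIdeal K (dM n (k + 1)))
      (srIdeal_anti (by rw [dM_union]; exact Set.subset_union_left))
      (srIdeal_anti (by rw [dM_union]; exact Set.subset_union_right))
      (srIdeal_anti (by rw [dM_inter]; exact Set.inter_subset_left))
      (srIdeal_anti (by rw [dM_inter]; exact Set.inter_subset_right))
      (srIdeal_inf_le (dM_union k) (dMa_isComplex _ _) (dMa_isComplex _ _))
      (le_srIdeal_sup (dM_inter k))
      (srIdeal K (ind (graphA n) (WT n k))) (srIdeal K (ind (graphA n) (WTa n k true)))
      (srIdeal K (ind (graphA n) (WTa n k false))) (srIdeal K (ind (graphA n) (WT n (k + 1))))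
      (srIdeal_anti (by rw [ind_WT_union]; exact Set.subset_union_left))
      (srIdeal_anti (by rw [ind_WT_union]; exact Set.subset_union_right))
      (srIdeal_anti (by rw [ind_WT_inter]; exact Set.inter_subset_left))
      (srIdeal_anti (by rw [ind_WT_inter]; exact Set.inter_subset_right))
      (srIdeal_inf_le (ind_WT_union k) (ind_isComplex _ _) (ind_isComplex _ _))
      (le_srIdeal_sup (ind_WT_inter k))
      _ (srIdeal_anti (ind_WTa_le k true)) (srIdeal_anti (ind_WTa_le k false)) _ m
      ((good_WTa k m hk true).ext_van _ X_ann m (by omega))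
      ((good_WTa k m hk false).ext_van _ X_ann m (by omega))
      (ih (k + 1) (by omega))

lemma not_subsingleton_ext :
    ¬ Subsingleton (Ext (cyc (maxIdeal K (Fin n ⊕ Fin n)))
      (cyc (srIdeal K (ind (graphA n) Set.univ))) ((n + 1) / 2)) := by
  intro hs
  obtain ⟨x, hx⟩ := nonvan (n := n) (K := K) ((n + 1) / 2) 0 (zero_add _)
  apply hx
  have l1 : srIdeal K (dM n 0) ≤ srIdeal K (ind (graphA n) Set.univ) := srIdeal_anti ind_univ_le
  have l2 : srIdeal K (ind (graphA n) Set.univ) ≤ srIdeal K (ind (graphA n) (WT n 0)) :=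
    srIdeal_anti (ind_mono _ (Set.subset_univ _))
  have hf : fac (srIdeal_anti (K := K) (ind_WT_le (n := n) 0)) = fac l1 ≫ fac l2 := by
    refine ModuleCat.hom_ext (LinearMap.ext fun x => ?_)
    obtain ⟨x, rfl⟩ := Submodule.mkQ_surjective _ x
    rfl
  rw [hf, ← Ext.mk₀_comp_mk₀, ← Ext.comp_assoc x (Ext.mk₀ (fac l1)) (Ext.mk₀ (fac l2))
    (add_zero _) (add_zero 0) (by omega),
    Subsingleton.elim (x.comp (Ext.mk₀ (fac l1)) (add_zero _)) 0, Ext.zero_comp]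

lemma ceil_half (n : ℕ) : ⌈(n : ℚ) / 2⌉₊ = (n + 1) / 2 := by
  apply le_antisymm
  · rw [Nat.ceil_le, div_le_iff₀ (by norm_num)]
    exact_mod_cast (by omega : n ≤ (n + 1) / 2 * 2)
  · have h := Nat.le_ceil ((n : ℚ) / 2)
    rw [div_le_iff₀ (by norm_num)] at h
    have h' : n ≤ ⌈(n : ℚ) / 2⌉₊ * 2 := by exact_mod_cast h
    omega

lemma depth_eq (hn : 2 ≤ n) :
    depthQuot (srIdeal K (ind (graphA n) Set.univ)) = (n + 1) / 2 := by
  have hlt := smul_lt (le_maxIdeal (K := K) (empty_mem_ind (graphA n) Set.univ))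
  have hub : ∀ r ∈ {r : ℕ | ∃ rs : List (MvPolynomial (Fin n ⊕ Fin n) K), rs.length = r ∧
      (∀ r ∈ rs, r ∈ maxIdeal K (Fin n ⊕ Fin n)) ∧
      RingTheory.Sequence.IsRegular
        (MvPolynomial (Fin n ⊕ Fin n) K ⧸ srIdeal K (ind (graphA n) Set.univ)) rs},
      r ≤ (n + 1) / 2 := by
    rintro r ⟨rs, hl, hm, hreg⟩
    by_contra hc
    exact not_subsingleton_ext (ModuleCat.subsingleton_ext_of_exists_isRegular
      (maxIdeal K (Fin n ⊕ Fin n)) (cyc (maxIdeal K (Fin n ⊕ Fin n))) supp_max.le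
      (cyc (srIdeal K (ind (graphA n) Set.univ))) hlt rs hm hreg ((n + 1) / 2) (by omega))
  have hmem := ModuleCat.exists_isRegular_of_exists_subsingleton_ext
    (maxIdeal K (Fin n ⊕ Fin n)) ((n + 1) / 2)
    (cyc (srIdeal K (ind (graphA n) Set.univ))) hlt (cyc (maxIdeal K (Fin n ⊕ Fin n)))
    supp_max ((good_univ hn).ext_van _ X_ann)
  exact le_antisymm (csSup_le ⟨_, hmem⟩ hub) (le_csSup ⟨_, hub⟩ hmem)

lemma sdepth_ge (hn : 2 ≤ n) :
    (n + 1) / 2 ≤ sdepthQuot (srIdeal K (ind (graphA n) Set.univ)) := by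
  refine le_csSup ⟨Fintype.card (Fin n ⊕ Fin n), ?_⟩
    (HasPart.exists_decomp (ind_isComplex _ _) (good_univ hn).hasPart)
  rintro r ⟨D, hD⟩
  by_cases hm : 0 < D.m
  · exact (hD ⟨0, hm⟩).trans (Finset.card_le_univ _)
  · exfalso
    have h1 := D.internal.submodule_iSup_eq_top
    have : IsEmpty (Fin D.m) := by
      obtain h : D.m = 0 := by omega
      rw [h]; infer_instance
    rw [iSup_of_empty] at h1
    have h2 : (Ideal.Quotient.mk (srIdeal K (ind (graphA n) Set.univ)) 1) ∈
        (⊥ : Submodule K (MvPolynomial (Fin n ⊕ Fin n) K ⧸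
          srIdeal K (ind (graphA n) Set.univ))) := h1 ▸ Submodule.mem_top
    rw [Submodule.mem_bot, Ideal.Quotient.eq_zero_iff_mem] at h2
    exact one_notMem (ind_isComplex _ _) (empty_mem_ind _ _) h2

end Final

end Ladder

theorem sdepth_ge_depth_graphA (n : ℕ) (hn : 2 ≤ n) (K : Type*) [Field K] :
    sdepthQuot (edgeIdeal K (graphA n)) ≥ depthQuot (edgeIdeal K (graphA n)) ∧
    depthQuot (edgeIdeal K (graphA n)) = ⌈(n : ℚ) / 2⌉₊ := by
  rw [Ladder.edgeIdeal_eq, Ladder.depth_eq hn, Ladder.ceil_half]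
  exact ⟨Ladder.sdepth_ge hn, rfl⟩
end

section
/- Let n ≥ 2, let K be a field, let A_n be the ladder graph on 2n vertices, and let S = K[V(A_n)]. If n ≡ 0 (mod 2), then sdepth(S/I(A_n)) ∈ {⌈n/2⌉, ⌈(n+1)/2⌉}; otherwise (n odd), sdepth(S/I(A_n)) = ⌈n/2⌉. -/
open MvPolynomial

section Helpers

/-- `σ` is an independent set of `G`. -/
def IndepSet {V : Type*} (G : SimpleGraph V) (σ : Finset V) : Prop :=
  ∀ a ∈ σ, ∀ b ∈ σ, ¬ G.Adj a b

/-- The independent subsets of `W` can be partitioned into intervals with tops of size `≥ d`. -/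
def IntPart {V : Type*} (G : SimpleGraph V) (W : Finset V) (d : ℕ) : Prop :=
  ∃ c : Finset V → Finset V × Finset V, ∀ σ, σ ⊆ W → IndepSet G σ →
    (c σ).1 ⊆ σ ∧ σ ⊆ (c σ).2 ∧ (c σ).2 ⊆ W ∧ IndepSet G (c σ).2 ∧ d ≤ (c σ).2.card ∧
    ∀ τ, (c σ).1 ⊆ τ → τ ⊆ (c σ).2 → c τ = c σ

lemma IndepSet.mono {V : Type*} {G : SimpleGraph V} {σ τ : Finset V} (h : IndepSet G τ)
    (hs : σ ⊆ τ) : IndepSet G σ :=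
  fun a ha b hb => h a (hs ha) b (hs hb)

lemma intPart_zero {V : Type*} (G : SimpleGraph V) (W : Finset V) : IntPart G W 0 :=
  ⟨fun σ => (σ, σ), fun _ hσ hi => ⟨subset_rfl, subset_rfl, hσ, hi, Nat.zero_le _,
    fun _ h1 h2 => by rw [Finset.Subset.antisymm h2 h1]⟩⟩

lemma IntPart.mono {V : Type*} {G : SimpleGraph V} {W : Finset V} {d e : ℕ} (h : IntPart G W d)
    (he : e ≤ d) : IntPart G W e := by
  obtain ⟨c, hc⟩ := h
  refine ⟨c, fun σ h1 h2 => ?_⟩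
  obtain ⟨a1, a2, a3, a4, a5, a6⟩ := hc σ h1 h2
  exact ⟨a1, a2, a3, a4, he.trans a5, a6⟩

lemma intPart_isolated {V : Type*} [DecidableEq V] {G : SimpleGraph V} {W : Finset V} {d : ℕ}
    (v : V) (hv : v ∈ W) (hiso : ∀ w ∈ W, ¬ G.Adj v w) (h : IntPart G (W.erase v) d) :
    IntPart G W (d + 1) := by
  obtain ⟨c, hc⟩ := h
  refine ⟨fun σ => ((c (σ.erase v)).1, insert v (c (σ.erase v)).2), fun σ h1 h2 => ?_⟩
  obtain ⟨a1, a2, a3, a4, a5, a6⟩ := hc (σ.erase v) (Finset.erase_subset_erase v h1)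
    (h2.mono (Finset.erase_subset _ _))
  have hvB : v ∉ (c (σ.erase v)).2 := fun hh => by simpa using a3 hh
  have hBW : (c (σ.erase v)).2 ⊆ W := a3.trans (Finset.erase_subset _ _)
  refine ⟨a1.trans (Finset.erase_subset _ _), ?_, ?_, ?_, ?_, ?_⟩
  · exact Finset.subset_insert_iff.2 a2
  · exact Finset.insert_subset hv hBW
  · intro a ha b hb hab
    simp only [Finset.mem_insert] at ha hb
    rcases ha with rfl | ha
    · rcases hb with rfl | hb
      · exact G.irrefl hab
      · exact hiso _ (hBW hb) hab
    · rcases hb with rfl | hb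
      · exact hiso _ (hBW ha) hab.symm
      · exact a4 a ha b hb hab
  · simp only [Finset.card_insert_of_notMem hvB]; omega
  · intro τ t1 t2
    have := a6 (τ.erase v) (fun x hx => Finset.mem_erase.2 ⟨fun h => by
      subst h; exact hvB (a2 (a1 hx)), t1 hx⟩) (Finset.subset_insert_iff.1 t2)
    simp only [this]

lemma intPart_step {V : Type*} [DecidableEq V] {G : SimpleGraph V} {W W2 : Finset V} {d : ℕ}
    (v : V) (hv : v ∈ W) (hW2 : ∀ w, w ∈ W2 ↔ w ∈ W ∧ w ≠ v ∧ ¬ G.Adj v w)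
    (h1 : IntPart G (W.erase v) (d + 1)) (h2 : IntPart G W2 d) :
    IntPart G W (d + 1) := by
  obtain ⟨c1, hc1⟩ := h1
  obtain ⟨c2, hc2⟩ := h2
  refine ⟨fun σ => if v ∈ σ then (insert v (c2 (σ.erase v)).1, insert v (c2 (σ.erase v)).2)
    else c1 σ, fun σ s1 s2 => ?_⟩
  by_cases hvσ : v ∈ σ
  · simp only [hvσ, if_true]
    obtain ⟨a1, a2, a3, a4, a5, a6⟩ := hc2 (σ.erase v) (fun x hx => by
      rw [Finset.mem_erase] at hx
      exact (hW2 x).2 ⟨s1 hx.2, hx.1, s2 v hvσ x hx.2⟩) (s2.mono (Finset.erase_subset _ _))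
    have hvB : v ∉ (c2 (σ.erase v)).2 := fun hh => ((hW2 v).1 (a3 hh)).2.1 rfl
    refine ⟨?_, ?_, ?_, ?_, ?_, ?_⟩
    · exact Finset.insert_subset hvσ (a1.trans (Finset.erase_subset _ _))
    · exact Finset.subset_insert_iff.2 a2
    · exact Finset.insert_subset hv (fun x hx => ((hW2 x).1 (a3 hx)).1)
    · intro a ha b hb hab
      simp only [Finset.mem_insert] at ha hb
      rcases ha with rfl | ha
      · rcases hb with rfl | hb
        · exact G.irrefl hab
        · exact ((hW2 _).1 (a3 hb)).2.2 hab
      · rcases hb with rfl | hb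
        · exact ((hW2 _).1 (a3 ha)).2.2 hab.symm
        · exact a4 a ha b hb hab
    · simp only [Finset.card_insert_of_notMem hvB]; omega
    · intro τ t1 t2
      have hvτ : v ∈ τ := t1 (Finset.mem_insert_self _ _)
      have := a6 (τ.erase v) (fun x hx => Finset.mem_erase.2 ⟨fun h => by
        subst h; exact hvB (a2 (a1 hx)), t1 (Finset.mem_insert_of_mem hx)⟩)
        (Finset.subset_insert_iff.1 t2)
      simp only [this, hvτ, if_true]
  · simp only [hvσ, if_false]
    obtain ⟨a1, a2, a3, a4, a5, a6⟩ := hc1 σ (fun x hx => Finset.mem_erase.2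
      ⟨fun h => hvσ (h ▸ hx), s1 hx⟩) s2
    refine ⟨a1, a2, a3.trans (Finset.erase_subset _ _), a4, a5, fun τ t1 t2 => ?_⟩
    have hvτ : v ∉ τ := fun hh => by simpa using a3 (t2 hh)
    simp only [hvτ, if_false]
    exact a6 τ t1 t2

/-- Column of a vertex of the ladder. -/
def lcol {N : ℕ} : Fin N ⊕ Fin N → ℕ
  | .inl i => i
  | .inr i => i

/-- Side of a vertex of the ladder. -/
def lside {N : ℕ} : Fin N ⊕ Fin N → Bool
  | .inl _ => true
  | .inr _ => false

/-- The vertex with given side and column. -/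
def lvert {N : ℕ} (s : Bool) (i : ℕ) (hi : i < N) : Fin N ⊕ Fin N :=
  if s then .inl ⟨i, hi⟩ else .inr ⟨i, hi⟩

@[simp] lemma lcol_lvert {N : ℕ} (s : Bool) (i : ℕ) (hi : i < N) : lcol (lvert s i hi) = i := by
  cases s <;> simp [lvert, lcol]

@[simp] lemma lside_lvert {N : ℕ} (s : Bool) (i : ℕ) (hi : i < N) : lside (lvert s i hi) = s := by
  cases s <;> simp [lvert, lside]

lemma lcol_lt {N : ℕ} (v : Fin N ⊕ Fin N) : lcol v < N := by
  rcases v with i | i <;> exact i.2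

lemma lext {N : ℕ} (v w : Fin N ⊕ Fin N) : v = w ↔ lcol v = lcol w ∧ lside v = lside w := by
  rcases v with i | i <;> rcases w with j | j <;> simp [lcol, lside, Fin.ext_iff]

lemma graphA_adj {N : ℕ} (v w : Fin N ⊕ Fin N) : (graphA N).Adj v w ↔
    (lside v = lside w ∧ (lcol v + 1 = lcol w ∨ lcol w + 1 = lcol v)) ∨
    (lside v ≠ lside w ∧ lcol v = lcol w) := by
  rcases v with i | i <;> rcases w with j | j <;>
    simp [graphA, lcol, lside, Fin.ext_iff] <;> omega

/-- Columns `< n` together with the vertex at side `s` in column `n`. -/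
def bset (N n : ℕ) (s : Bool) : Finset (Fin N ⊕ Fin N) :=
  Finset.univ.filter (fun v => lcol v < n ∨ (lcol v = n ∧ lside v = s))

lemma mem_bset {N n : ℕ} {s : Bool} (v : Fin N ⊕ Fin N) :
    v ∈ bset N n s ↔ lcol v < n ∨ (lcol v = n ∧ lside v = s) := by
  simp [bset]

lemma intPart_bset (N : ℕ) : ∀ n, n < N → ∀ s, IntPart (graphA N) (bset N n s) (n / 2 + 1) := by
  intro n
  induction n using Nat.strong_induction_on with
  | _ n ih =>
    intro hn s
    rcases n with _ | n
    · refine intPart_isolated (lvert s 0 hn) (by simp [mem_bset]) ?_ (intPart_zero _ _)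
      intro w hw
      rw [mem_bset] at hw
      rw [graphA_adj]
      simp only [lcol_lvert, lside_lvert]
      grind
    · have hn' : n < N := by omega
      have key : IntPart (graphA N) ((bset N (n + 1) s).erase (lvert s n hn')) (n / 2 + 1 + 1) := by
        refine intPart_isolated (lvert s (n + 1) hn) (by simp [mem_bset, lext]) ?_ ?_
        · intro w hw
          rw [Finset.mem_erase, mem_bset, ne_eq, lext] at hw
          rw [graphA_adj]
          simp only [lcol_lvert, lside_lvert] at hw ⊢
          grind
        · convert ih n (by omega) hn' (!s) using 1
          ext w
          simp only [Finset.mem_erase, mem_bset, ne_eq, lext, lcol_lvert, lside_lvert]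
          grind
      have hv : lvert s n hn' ∈ bset N (n + 1) s := by simp [mem_bset]
      rcases n with _ | n
      · classical
        refine intPart_step (W2 := (bset N (0 + 1) s).filter
          (fun w => w ≠ lvert s 0 hn' ∧ ¬ (graphA N).Adj (lvert s 0 hn') w)) _ hv ?_
          (key.mono (by omega)) (intPart_zero _ _)
        intro w
        simp
      · have := ih n (by omega) (by omega) (!s)
        have e : (n + 1 + 1) / 2 = n / 2 + 1 := by omega
        rw [e]
        refine intPart_step _ hv ?_ (key.mono (by omega)) this
        intro w
        simp only [mem_bset, ne_eq, lext, graphA_adj, lcol_lvert, lside_lvert]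
        grind

lemma intPart_univ (N : ℕ) (hN : 2 ≤ N) :
    IntPart (graphA N) Finset.univ ((N + 1) / 2) := by
  obtain ⟨n, rfl⟩ : ∃ n, N = n + 2 := ⟨N - 2, by omega⟩
  have e : (n + 2 + 1) / 2 = (n + 1) / 2 + 1 := by omega
  rw [e]
  refine intPart_step (W2 := bset (n + 2) n false) (lvert true (n + 1) (by omega))
    (Finset.mem_univ _) ?_ ?_ ((intPart_bset (n + 2) n (by omega) false).mono (by omega))
  · intro w
    have := lcol_lt w
    simp only [mem_bset, ne_eq, lext, graphA_adj, lcol_lvert, lside_lvert, Finset.mem_univ]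
    grind
  · convert intPart_bset (n + 2) (n + 1) (by omega) false using 1
    ext w
    have := lcol_lt w
    simp only [mem_bset, ne_eq, lext, Finset.mem_erase, lcol_lvert, lside_lvert, Finset.mem_univ]
    grind

variable {K : Type*} [Field K] {V : Type*}

lemma edgeIdeal_eq (G : SimpleGraph V) : edgeIdeal K G = Ideal.span
    ((fun s => monomial s (1 : K)) ''
      {s | ∃ i j, G.Adj i j ∧ s = Finsupp.single i 1 + Finsupp.single j 1}) := by
  unfold edgeIdeal
  congr 1
  ext m
  constructor
  · rintro ⟨i, j, h, rfl⟩
    exact ⟨_, ⟨i, j, h, rfl⟩, by simp [X, monomial_mul]⟩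
  · rintro ⟨_, ⟨i, j, h, rfl⟩, rfl⟩
    exact ⟨i, j, h, by simp [X, monomial_mul]⟩

lemma pair_le_iff {i j : V} (h : i ≠ j) (w : V →₀ ℕ) :
    Finsupp.single i 1 + Finsupp.single j 1 ≤ w ↔ i ∈ w.support ∧ j ∈ w.support := by
  classical
  simp only [Finsupp.mem_support_iff, Finsupp.le_def, Finsupp.add_apply, Finsupp.single_apply]
  constructor
  · intro hw
    have h1 := hw i
    have h2 := hw j
    simp at h1 h2
    omega
  · rintro ⟨h1, h2⟩ x
    by_cases hi : i = x
    · subst hi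
      simp [h.symm]; omega
    · by_cases hj : j = x
      · subst hj
        simp [h]; omega
      · simp [hi, hj]

lemma mem_edgeIdeal (G : SimpleGraph V) (f : MvPolynomial V K) :
    f ∈ edgeIdeal K G ↔ ∀ w ∈ f.support, ¬ IndepSet G w.support := by
  rw [edgeIdeal_eq, mem_ideal_span_monomial_image]
  refine forall₂_congr fun w _ => ?_
  unfold IndepSet
  push Not
  constructor
  · rintro ⟨_, ⟨i, j, h, rfl⟩, hle⟩
    rw [pair_le_iff h.ne] at hle
    exact ⟨i, hle.1, j, hle.2, h⟩
  · rintro ⟨i, hi, j, hj, h⟩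
    exact ⟨_, ⟨i, j, h, rfl⟩, (pair_le_iff h.ne w).2 ⟨hi, hj⟩⟩

/-- class of a monomial in the quotient -/
noncomputable def qmon (K : Type*) [Field K] (G : SimpleGraph V) (w : V →₀ ℕ) :
    MvPolynomial V K ⧸ edgeIdeal K G :=
  Ideal.Quotient.mk (edgeIdeal K G) (monomial w (1 : K))

lemma qmon_ne_zero_iff (G : SimpleGraph V) (w : V →₀ ℕ) :
    qmon K G w ≠ 0 ↔ IndepSet G w.support := by
  classical
  rw [qmon, ne_eq, Ideal.Quotient.eq_zero_iff_mem, mem_edgeIdeal]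
  simp [support_monomial]

lemma qmon_linInd (G : SimpleGraph V) :
    LinearIndependent K (fun w : {w : V →₀ ℕ // IndepSet G w.support} => qmon K G w) := by
  classical
  rw [linearIndependent_iff']
  intro s g hg i hi
  have h1 : Ideal.Quotient.mk (edgeIdeal K G)
      (∑ w ∈ s, monomial (w : V →₀ ℕ) (g w)) = 0 := by
    rw [← hg, map_sum]
    refine Finset.sum_congr rfl fun w _ => ?_
    have : monomial (w : V →₀ ℕ) (g w) = g w • monomial (w : V →₀ ℕ) (1 : K) := by
      simp [smul_monomial]
    rw [this]
    rfl
  rw [Ideal.Quotient.eq_zero_iff_mem, mem_edgeIdeal] at h1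
  by_contra hne
  refine h1 i ?_ i.2
  rw [mem_support_iff, coeff_sum]
  simp only [coeff_monomial]
  rw [Finset.sum_eq_single i]
  · simpa using hne
  · intro b _ hb
    rw [if_neg]
    exact fun h => hb (Subtype.ext h)
  · exact fun h => (h hi).elim

lemma qmon_span (G : SimpleGraph V) :
    Submodule.span K (Set.range (fun w : {w : V →₀ ℕ // IndepSet G w.support} => qmon K G w))
      = ⊤ := by
  rw [eq_top_iff]
  rintro x -
  obtain ⟨f, rfl⟩ := Ideal.Quotient.mk_surjective x
  induction f using MvPolynomial.induction_on' with
  | monomial w a =>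
    have : Ideal.Quotient.mk (edgeIdeal K G) (monomial w a) = a • qmon K G w := by
      have : monomial w a = a • monomial w (1 : K) := by simp [smul_monomial]
      rw [this]
      rfl
    rw [this]
    refine Submodule.smul_mem _ _ ?_
    by_cases h : IndepSet G w.support
    · exact Submodule.subset_span ⟨⟨w, h⟩, rfl⟩
    · rw [← qmon_ne_zero_iff (K := K), not_not] at h
      rw [h]
      exact Submodule.zero_mem _
  | add p q hp hq =>
    rw [map_add]
    exact Submodule.add_mem _ hp hq

lemma upper_bound (G : SimpleGraph V) [DecidableEq V] (F : Finset V) (hF : IndepSet G F)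
    (hmax : ∀ v, v ∉ F → ∃ w ∈ F, G.Adj v w)
    (D : StanleyDecomposition (edgeIdeal K G)) : ∃ j, (D.Z j).card ≤ F.card := by
  classical
  let w0 : V →₀ ℕ := Finsupp.indicator F (fun _ _ => 1)
  have hw0 : w0.support = F := by
    ext x
    simp [w0, Finsupp.indicator_apply]
  have hind : ∀ j (a : V →₀ ℕ), a.support ⊆ D.Z j → IndepSet G (D.u j + a).support := by
    intro j a ha
    rw [← qmon_ne_zero_iff (K := K), qmon]
    have hne := (D.free j).ne_zero ⟨a, ha⟩
    exact hne
  have hex : ∃ j, ∃ a : V →₀ ℕ, a.support ⊆ D.Z j ∧ w0 = D.u j + a := by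
    by_contra hno
    push Not at hno
    have htop := D.internal.submodule_iSup_eq_top
    have hw0' : IndepSet G w0.support := hw0 ▸ hF
    refine (qmon_linInd (K := K) G).notMem_span_image (s := {w | w ≠ ⟨w0, hw0'⟩})
      (x := ⟨w0, hw0'⟩) (by simp) ?_
    have hle : (⨆ j, stanleySpace (edgeIdeal K G) (D.u j) (D.Z j)) ≤ Submodule.span K
        ((fun w : {w : V →₀ ℕ // IndepSet G w.support} => qmon K G w) ''
          {w | w ≠ ⟨w0, hw0'⟩}) := by
      refine iSup_le fun j => Submodule.span_mono ?_
      rintro _ ⟨a, ha, rfl⟩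
      exact ⟨⟨D.u j + a, hind j a ha⟩, fun h => hno j a ha (congrArg Subtype.val h).symm, rfl⟩
    exact hle (htop ▸ Submodule.mem_top)
  obtain ⟨j, a, ha, hw⟩ := hex
  refine ⟨j, Finset.card_le_card fun z hz => ?_⟩
  by_contra hzF
  obtain ⟨y, hy, hzy⟩ := hmax z hzF
  have hz' := hind j (a + Finsupp.single z 1) (by
    intro x hx
    rcases Finset.mem_union.1 (Finsupp.support_add hx) with h | h
    · exact ha h
    · have := Finsupp.support_single_subset h
      rw [Finset.mem_singleton] at this
      exact this ▸ hz)
  rw [← add_assoc, ← hw] at hz'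
  refine hz' z ?_ y ?_ hzy
  · simp
  · rw [← hw0] at hy
    rw [Finsupp.mem_support_iff] at hy ⊢
    rw [Finsupp.add_apply]
    omega

lemma lower_bound [Fintype V] [DecidableEq V] (G : SimpleGraph V) (d : ℕ)
    (h : IntPart G Finset.univ d) :
    ∃ D : StanleyDecomposition (edgeIdeal K G), ∀ j, d ≤ (D.Z j).card := by
  classical
  obtain ⟨c, hc⟩ := h
  let L : Finset (Finset V × Finset V) := (Finset.univ.filter (fun σ => IndepSet G σ)).image c
  let e := L.equivFin.symm
  have hL : ∀ j, ∃ σ, IndepSet G σ ∧ c σ = (e j : Finset V × Finset V) := by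
    intro j
    obtain ⟨σ, h1, h2⟩ := Finset.mem_image.1 (e j).2
    exact ⟨σ, (Finset.mem_filter.1 h1).2, h2⟩
  let ind : Finset V → (V →₀ ℕ) := fun A => Finsupp.indicator A (fun _ _ => 1)
  let u : Fin L.card → (V →₀ ℕ) := fun j => ind (e j).1.1
  let Z : Fin L.card → Finset V := fun j => (e j).1.2
  have hpos : ∀ A x, ind A x = if x ∈ A then 1 else 0 := by
    intro A x
    simp [ind, Finsupp.indicator_apply]
  have hsub : ∀ j, (e j).1.1 ⊆ (e j).1.2 := by
    intro j
    obtain ⟨σ, h1, h2⟩ := hL j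
    rw [← h2]
    exact (hc σ (Finset.subset_univ _) h1).1.trans (hc σ (Finset.subset_univ _) h1).2.1
  have hsupp : ∀ j (a : V →₀ ℕ), a.support ⊆ Z j →
      (e j).1.1 ⊆ (u j + a).support ∧ (u j + a).support ⊆ Z j := by
    intro j a ha
    refine ⟨fun x hx => ?_, fun x hx => ?_⟩
    · simp [u, hpos, hx]
    · by_contra hxZ
      have h1 : x ∉ (e j).1.1 := fun h => hxZ (hsub j h)
      have h2 : a x = 0 := by
        by_contra h
        exact hxZ (ha (Finsupp.mem_support_iff.2 h))
      simp [u, hpos, h1, h2] at hx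
  have hind : ∀ j (a : V →₀ ℕ), a.support ⊆ Z j → IndepSet G (u j + a).support := by
    intro j a ha
    refine IndepSet.mono ?_ (hsupp j a ha).2
    obtain ⟨σ, h1, h2⟩ := hL j
    simp only [Z]
    rw [← h2]
    exact (hc σ (Finset.subset_univ _) h1).2.2.2.1
  have hdet : ∀ j (a : V →₀ ℕ), a.support ⊆ Z j →
      c (u j + a).support = (e j : Finset V × Finset V) := by
    intro j a ha
    obtain ⟨σ, h1, h2⟩ := hL j
    have h3 := hsupp j a ha
    simp only [Z] at h3
    rw [← h2] at h3 ⊢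
    exact (hc σ (Finset.subset_univ _) h1).2.2.2.2.2 _ h3.1 h3.2
  let T : Fin L.card → Set {w : V →₀ ℕ // IndepSet G w.support} :=
    fun j => {w | ∃ a : V →₀ ℕ, a.support ⊆ Z j ∧ (w : V →₀ ℕ) = u j + a}
  have hT : ∀ j, stanleySpace (edgeIdeal K G) (u j) (Z j) = Submodule.span K
      ((fun w : {w : V →₀ ℕ // IndepSet G w.support} => qmon K G w) '' T j) := by
    intro j
    unfold stanleySpace
    congr 1
    ext x
    constructor
    · rintro ⟨a, ha, rfl⟩
      exact ⟨⟨u j + a, hind j a ha⟩, ⟨a, ha, rfl⟩, rfl⟩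
    · rintro ⟨w, ⟨a, ha, hw⟩, rfl⟩
      exact ⟨a, ha, by simp only [qmon, hw]⟩
  have hcov : ∀ w, ∃ j, w ∈ T j := by
    rintro ⟨w, hw⟩
    obtain ⟨a1, a2, -⟩ := hc w.support (Finset.subset_univ _) hw
    let p : L := ⟨c w.support, Finset.mem_image.2 ⟨_, by simpa using hw, rfl⟩⟩
    have hp : (e (e.symm p)).1 = c w.support := by simp [p]
    refine ⟨e.symm p, w - u (e.symm p), ?_, ?_⟩
    · simp only [Z, hp]
      refine subset_trans ?_ a2
      exact Finsupp.support_mono tsub_le_self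
    · refine (add_tsub_cancel_of_le ?_).symm
      intro x
      simp only [u, hpos, hp]
      split_ifs with hx
      · exact Nat.one_le_iff_ne_zero.2 (Finsupp.mem_support_iff.1 (a1 hx))
      · exact Nat.zero_le _
  refine ⟨⟨L.card, u, Z, ?_, ?_⟩, ?_⟩
  · intro j
    refine (qmon_linInd (K := K) G).comp
      (fun a : {a : V →₀ ℕ // a.support ⊆ Z j} => ⟨u j + a, hind j a a.2⟩) ?_
    intro a b hab
    exact Subtype.ext (add_left_cancel (congrArg Subtype.val hab))
  · rw [DirectSum.isInternal_submodule_iff_iSupIndep_and_iSup_eq_top]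
    simp only [hT]
    constructor
    · intro j
      simp only [← Submodule.span_iUnion, ← Set.image_iUnion]
      refine (qmon_linInd (K := K) G).disjoint_span_image ?_
      rw [Set.disjoint_left]
      rintro w ⟨a, ha, hw⟩ hw2
      simp only [Set.mem_iUnion] at hw2
      obtain ⟨i, hij, b, hb, hw'⟩ := hw2
      refine hij (e.injective (Subtype.ext ?_))
      rw [← hdet i b hb, ← hdet j a ha, ← hw, ← hw']
    · rw [← Submodule.span_iUnion, ← Set.image_iUnion, Set.iUnion_eq_univ_iff.2 hcov,
        Set.image_univ, qmon_span]
  · intro j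
    obtain ⟨σ, h1, h2⟩ := hL j
    change d ≤ (e j).1.2.card
    rw [← h2]
    exact (hc σ (Finset.subset_univ _) h1).2.2.2.2.1

/-- A small maximal independent set of the ladder. -/
def domSet (n : ℕ) : Finset (Fin n ⊕ Fin n) :=
  Finset.univ.filter (fun v => (lcol v % 2 = 0 ∧ (lside v = true ↔ lcol v % 4 = 0)) ∨
    (n % 2 = 0 ∧ lcol v + 1 = n ∧ (lside v = true ↔ n % 4 = 0)))

lemma mem_domSet {n : ℕ} (v : Fin n ⊕ Fin n) : v ∈ domSet n ↔
    (lcol v % 2 = 0 ∧ (lside v = true ↔ lcol v % 4 = 0)) ∨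
    (n % 2 = 0 ∧ lcol v + 1 = n ∧ (lside v = true ↔ n % 4 = 0)) := by
  simp [domSet]

lemma domSet_indep (n : ℕ) : IndepSet (graphA n) (domSet n) := by
  intro a ha b hb
  rw [mem_domSet] at ha hb
  rw [graphA_adj]
  have := lcol_lt a
  have := lcol_lt b
  cases h1 : lside a <;> cases h2 : lside b <;> simp only [h1, h2] at ha hb ⊢ <;> simp at ha hb ⊢ <;> omega

lemma domSet_max (n : ℕ) (v : Fin n ⊕ Fin n) (hv : v ∉ domSet n) :
    ∃ w ∈ domSet n, (graphA n).Adj v w := by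
  have hc := lcol_lt v
  rw [mem_domSet] at hv
  by_cases he : lcol v % 2 = 0
  · refine ⟨lvert (!lside v) (lcol v) hc, ?_, ?_⟩
    · rw [mem_domSet]
      simp only [lcol_lvert, lside_lvert]
      cases h : lside v <;> simp only [h] at hv ⊢ <;> simp at hv ⊢ <;> omega
    · rw [graphA_adj]
      simp
  · by_cases hs : lside v = true ↔ (lcol v - 1) % 4 = 0
    · refine ⟨lvert (lside v) (lcol v - 1) (by omega), ?_, ?_⟩
      · rw [mem_domSet]
        simp only [lcol_lvert, lside_lvert]
        exact Or.inl ⟨by omega, hs⟩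
      · rw [graphA_adj]
        simp only [lcol_lvert, lside_lvert]
        exact Or.inl ⟨trivial, by omega⟩
    · have hlt : lcol v + 1 < n := by
        by_contra hge
        cases h : lside v <;> simp only [h] at hv hs <;> simp at hv hs <;> omega
      refine ⟨lvert (lside v) (lcol v + 1) hlt, ?_, ?_⟩
      · rw [mem_domSet]
        simp only [lcol_lvert, lside_lvert]
        cases h : lside v <;> simp only [h] at hs ⊢ <;> simp at hs ⊢ <;> omega
      · rw [graphA_adj]
        simp

lemma domSet_card (n : ℕ) : (domSet n).card ≤ n / 2 + 1 := by
  have : (domSet n).card ≤ (Finset.range (n / 2 + 1)).card := by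
    refine Finset.card_le_card_of_injOn (fun v => (lcol v + 1) / 2) ?_ ?_
    · intro v _
      have := lcol_lt v
      simp
      omega
    · intro a ha b hb hab
      have ha := (mem_domSet a).1 ha
      have hb := (mem_domSet b).1 hb
      have := lcol_lt a
      have := lcol_lt b
      rw [lext]
      dsimp only at hab
      cases h1 : lside a <;> cases h2 : lside b <;> simp only [h1, h2] at ha hb ⊢ <;> simp at ha hb ⊢ <;> omega
  simpa using this

end Helpers

theorem sdepth_graphA (n : ℕ) (hn : 2 ≤ n) (K : Type*) [Field K] :
    (n % 2 = 0 → sdepthQuot (edgeIdeal K (graphA n)) ∈ ({⌈(n : ℚ) / 2⌉₊, ⌈((n : ℚ) + 1) / 2⌉₊} : Set ℕ)) ∧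
    (n % 2 ≠ 0 → sdepthQuot (edgeIdeal K (graphA n)) = ⌈(n : ℚ) / 2⌉₊) := by
  have hub : ∀ k ∈ {k : ℕ | ∃ D : StanleyDecomposition (edgeIdeal K (graphA n)),
      ∀ j, k ≤ (D.Z j).card}, k ≤ n / 2 + 1 := by
    rintro k ⟨D, hD⟩
    obtain ⟨j, hj⟩ := upper_bound (graphA n) (domSet n) (domSet_indep n) (domSet_max n) D
    exact (hD j).trans (hj.trans (domSet_card n))
  have hlb := lower_bound (K := K) (graphA n) _ (intPart_univ n hn)
  have h1 : sdepthQuot (edgeIdeal K (graphA n)) ≤ n / 2 + 1 := csSup_le ⟨_, hlb⟩ hub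
  have h2 : (n + 1) / 2 ≤ sdepthQuot (edgeIdeal K (graphA n)) := le_csSup ⟨_, hub⟩ hlb
  have c1 : ∀ m : ℕ, ⌈(m : ℚ) / 2⌉₊ = (m + 1) / 2 := by
    intro m
    refine eq_of_forall_ge_iff fun k => ?_
    rw [Nat.ceil_le, div_le_iff₀ (by norm_num)]
    have : (m : ℚ) ≤ k * 2 ↔ m ≤ k * 2 := by exact_mod_cast Iff.rfl
    rw [this]
    omega
  have c2 : ⌈((n : ℚ) + 1) / 2⌉₊ = (n + 2) / 2 := by
    have := c1 (n + 1)
    push_cast at this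
    exact this
  rw [c1, c2]
  constructor
  · intro h
    simp only [Set.mem_insert_iff, Set.mem_singleton_iff]
    omega
  · intro h
    omega
end
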